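/- arXiv:2504.08936 — 2 statements merged into one kernel-verified Lean document; each statement's English description precedes it below -/
import Mathlib

section
/- Every 23-tough $(P_4 \cup P_1)$-free graph on at least three vertices is Hamiltonian. -/
open SimpleGraph

/-- The number of connected components of `G - S`. -/
noncomputable def ncomps {V : Type*} (G : SimpleGraph V) (S : Set V) : ℕ :=
  Nat.card (G.induce Sᶜ).ConnectedComponent

/-- The graph `P₄ ∪ P₁`: a path on four vertices plus an isolated vertex. -/
def P4P1 : SimpleGraph (Fin 5) :=
  SimpleGraph.fromEdgeSet {s((0 : Fin 5), (1 : Fin 5)), s((1 : Fin 5), (2 : Fin 5)),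
    s((2 : Fin 5), (3 : Fin 5))}

/-- `G` has no induced subgraph isomorphic to `P₄ ∪ P₁`. -/
def P4P1Free {V : Type*} (G : SimpleGraph V) : Prop := IsEmpty (P4P1 ↪g G)

/-- `G` has no induced subgraph isomorphic to `P₄`. -/
def P4Free {V : Type*} (G : SimpleGraph V) : Prop := IsEmpty (SimpleGraph.pathGraph 4 ↪g G)

/-- `G` is `t`-tough. -/
def Tough {V : Type*} (t : ℝ) (G : SimpleGraph V) : Prop :=
  ∀ S : Set V, 2 ≤ ncomps G S → t * (ncomps G S : ℝ) ≤ (S.ncard : ℝ)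

/-- `S` is a cutset of `G`, i.e. `G - S` is disconnected. -/
def IsCutset {V : Type*} (G : SimpleGraph V) (S : Set V) : Prop :=
  2 ≤ ncomps G S

/-- `S` is a scattering set of `G`. -/
def IsScatSet {V : Type*} (G : SimpleGraph V) (S : Set V) : Prop :=
  2 ≤ ncomps G S ∧ ∀ T : Set V, 2 ≤ ncomps G T →
    (ncomps G T : ℤ) - (T.ncard : ℤ) ≤ (ncomps G S : ℤ) - (S.ncard : ℤ)

/-- `S` is a maximal scattering set of `G`. -/
def IsMaxScatSet {V : Type*} (G : SimpleGraph V) (S : Set V) : Prop :=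
  IsScatSet G S ∧ ∀ T : Set V, IsScatSet G T → S ⊆ T → S = T

/-- `G` is `t`-tough with respect to `S`. -/
def ToughWrt {V : Type*} (t : ℝ) (G : SimpleGraph V) (S : Set V) : Prop :=
  ∀ W : Set V, 2 ≤ ncomps G W →
    (∀ c : (G.induce Sᶜ).ConnectedComponent,
      ∃ v : ↥Sᶜ, (G.induce Sᶜ).connectedComponentMk v = c ∧ (v : V) ∉ W) →
    t * (ncomps G W : ℝ) ≤ (W.ncard : ℝ)

/-- `a` and `b` occupy consecutive positions, in either order, of the list. -/
def Consec {V : Type*} : List V → V → V → Prop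
  | x :: y :: l, a, b => (a = x ∧ b = y) ∨ (a = y ∧ b = x) ∨ Consec (y :: l) a b
  | _, _, _ => False

/-- `a` is the last entry of `X` and `b` the first entry of `Y`. -/
def Junction {V : Type*} (X Y : List V) (a b : V) : Prop :=
  X.getLast? = some a ∧ Y.head? = some b

theorem consec_append {V : Type*} (X Y : List V) (a b : V) :
    Consec (X ++ Y) a b ↔
      Consec X a b ∨ Consec Y a b ∨ Junction X Y a b ∨ Junction X Y b a := by
  induction X with
  | nil => simp [Consec, Junction]
  | cons x X ih =>
    cases X with
    | nil =>
      cases Y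
      · simp [Consec, Junction]
      · simp [Consec, Junction]
        grind
    | cons y X =>
      simp only [List.cons_append, Consec] at ih ⊢
      rw [ih]
      simp only [Junction, List.getLast?_cons_cons]
      tauto

theorem Consec.mem {V : Type*} {L : List V} {a b : V} (h : Consec L a b) : a ∈ L := by
  induction L with
  | nil => simp [Consec] at h
  | cons x L ih =>
    cases L
    · simp [Consec] at h
    · simp only [Consec] at h
      grind

theorem consec_reverse {V : Type*} (L : List V) (a b : V) :
    Consec L.reverse a b ↔ Consec L a b := by
  induction L with
  | nil => simp [Consec]
  | cons x L ih =>
    rw [List.reverse_cons, consec_append, ih]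
    cases L
    · simp [Consec, Junction]
    · simp [Consec, Junction]
      grind

/-- `a` and `b` are consecutive in the cyclic list `L`. -/
def CycConsec {V : Type*} (L : List V) (a b : V) : Prop := Consec (L ++ L) a b

theorem cycConsec_append {V : Type*} {X Y : List V} (hX : X ≠ []) (hY : Y ≠ []) (a b : V) :
    CycConsec (X ++ Y) a b ↔ Consec X a b ∨ Consec Y a b ∨
      Junction X Y a b ∨ Junction X Y b a ∨ Junction Y X a b ∨ Junction Y X b a := by
  have h1 : (X ++ Y).head? = X.head? := by cases X <;> simp_all
  have h2 : (X ++ Y).getLast? = Y.getLast? := by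
    rw [List.getLast?_append_of_ne_nil _ hY]
  simp only [CycConsec, consec_append, Junction, h1, h2]
  tauto

theorem cycConsec_comm_append {V : Type*} (X Y : List V) (a b : V) :
    CycConsec (X ++ Y) a b ↔ CycConsec (Y ++ X) a b := by
  rcases eq_or_ne X [] with rfl | hX
  · simp
  rcases eq_or_ne Y [] with rfl | hY
  · simp
  rw [cycConsec_append hX hY, cycConsec_append hY hX]
  tauto

theorem cycConsec_reverse {V : Type*} (L : List V) (a b : V) :
    CycConsec L.reverse a b ↔ CycConsec L a b := by
  rw [CycConsec, ← List.reverse_append, consec_reverse, CycConsec]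

/-- The list enumerates the vertices of a cycle of `G`; a single edge is allowed. -/
def IsCyc {V : Type*} (G : SimpleGraph V) (L : List V) : Prop :=
  L ≠ [] ∧ L.Nodup ∧ (L ++ L).IsChain G.Adj

theorem IsCyc.isChain {V : Type*} {G : SimpleGraph V} {L : List V} (h : IsCyc G L) :
    L.IsChain G.Adj := h.2.2.left_of_append

theorem IsCyc.comm_append {V : Type*} {G : SimpleGraph V} {X Y : List V}
    (h : IsCyc G (X ++ Y)) : IsCyc G (Y ++ X) := by
  obtain ⟨h1, h2, h3⟩ := h
  refine ⟨fun e => h1 ?_, List.nodup_append_comm.1 h2, ?_⟩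
  · rw [List.append_eq_nil_iff] at e ⊢
    exact e.symm
  rcases eq_or_ne X [] with rfl | hX
  · simpa using h3
  rcases eq_or_ne Y [] with rfl | hY
  · simpa using h3
  have h4 : (X ++ (Y ++ X) ++ Y).IsChain G.Adj := by simpa using h3
  have h5 := (h4.left_of_append).right_of_append
  have h6 := h4.right_of_append
  have h7 : (X ++ Y).IsChain G.Adj := (h3.left_of_append)
  rw [List.isChain_append]
  refine ⟨h5, h5, ?_⟩
  rw [List.getLast?_append_of_ne_nil _ hX]
  have h8 : (Y ++ X).head? = Y.head? := by cases Y <;> simp_all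
  rw [h8]
  exact (List.isChain_append.1 h7).2.2

theorem IsCyc.reverse {V : Type*} {G : SimpleGraph V} {L : List V}
    (h : IsCyc G L) : IsCyc G L.reverse := by
  obtain ⟨h1, h2, h3⟩ := h
  refine ⟨by simpa using h1, by simpa using h2, ?_⟩
  rw [← List.reverse_append, List.isChain_reverse]
  exact h3.imp fun _ _ hab => hab.symm

/-- Every path that covers the cyclic list `L`, avoids `H`, joins two different vertices of `T`
and keeps the neighbours on `L` of all other vertices of `T` is ruled out. -/
def Linkable {V : Type*} (G : SimpleGraph V) (L : List V) (H T : Set V) : Prop :=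
  ∀ (P : List V) (x y : V), P.Nodup → P.IsChain G.Adj → P.head? = some x → P.getLast? = some y →
    x ∈ T → y ∈ T → x ≠ y → (∀ v ∈ L, v ∈ P) → (∀ v ∈ P, v ∉ H) →
    (∀ t ∈ T, t ≠ x → t ≠ y → ∀ b, CycConsec L t b → Consec P t b) → False

section Exchange

variable {V : Type*} {G : SimpleGraph V} {L X Y : List V} {H T : Set V}

theorem Linkable.comm_append (h : Linkable G (X ++ Y) H T) : Linkable G (Y ++ X) H T := by
  intro P x y h1 h2 h3 h4 h5 h6 h7 h8 h9 h10
  refine h P x y h1 h2 h3 h4 h5 h6 h7 (fun v hv => h8 v (by grind)) h9 ?_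
  intro t ht htx hty b hb
  exact h10 t ht htx hty b ((cycConsec_comm_append _ _ _ _).1 hb)

theorem Linkable.reverse (h : Linkable G L H T) : Linkable G L.reverse H T := by
  intro P x y h1 h2 h3 h4 h5 h6 h7 h8 h9 h10
  refine h P x y h1 h2 h3 h4 h5 h6 h7 (fun v hv => h8 v (by simpa using hv)) h9 ?_
  intro t ht htx hty b hb
  exact h10 t ht htx hty b ((cycConsec_reverse _ _ _).2 hb)

/-- Two vertices of a linkable set are not consecutive on the cycle. -/
theorem Linkable.not_ends (h : Linkable G L H T) (hL : IsCyc G L) (hH : ∀ v ∈ L, v ∉ H)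
    {x y : V} (hx : L.head? = some x) (hy : L.getLast? = some y) (hxy : x ≠ y)
    (hxT : x ∈ T) (hyT : y ∈ T) : False := by
  refine h L x y hL.2.1 hL.isChain hx hy hxT hyT hxy (fun _ => id) hH ?_
  intro t ht htx hty b hb
  simp only [CycConsec, consec_append, Junction] at hb
  grind

/-- Exchange of two cycle edges `t a`, `s b` for a path through `Z` from `a` to `b`. -/
theorem Linkable.exchange {Z : List V} (h : Linkable G (X ++ Y) H T) (hL : IsCyc G (X ++ Y))
    (hH : ∀ v ∈ X ++ Y, v ∉ H) {a s b t : V}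
    (ha : X.head? = some a) (hs : X.getLast? = some s)
    (hb : Y.head? = some b) (ht : Y.getLast? = some t) (hsT : s ∈ T) (htT : t ∈ T)
    (haT : a ∉ T) (hbT : b ∉ T) (hZ : Z.Nodup) (hZL : ∀ v ∈ Z, v ∉ X ++ Y) (hZH : ∀ v ∈ Z, v ∉ H)
    (hch : (b :: (Z ++ [a])).IsChain G.Adj) : False := by
  have hX : X ≠ [] := by rintro rfl; simp at ha
  have hY : Y ≠ [] := by rintro rfl; simp at hb
  obtain ⟨-, hnd, -⟩ := id hL
  have hch0 := hL.isChain
  obtain ⟨X', rfl⟩ : ∃ X', X = a :: X' := by cases X <;> simp_all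
  obtain ⟨Y', rfl⟩ : ∃ Y', Y = b :: Y' := by cases Y <;> simp_all
  have hts : t ≠ s := by
    rintro rfl
    exact (List.disjoint_of_nodup_append hnd) (List.mem_of_getLast? hs) (List.mem_of_getLast? ht)
  refine h ((b :: Y').reverse ++ Z ++ (a :: X')) t s ?_ ?_ ?_ ?_ htT hsT hts ?_ ?_ ?_
  · simp only [List.nodup_append, List.nodup_reverse, List.mem_reverse, List.mem_append] at hnd ⊢
    grind
  · have e : (b :: Y').reverse ++ Z ++ (a :: X') = Y'.reverse ++ (b :: (Z ++ a :: X')) := by simp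
    have h1 : (Y'.reverse ++ [b]).IsChain G.Adj := by
      have := hch0.right_of_append
      rw [← List.reverse_cons, List.isChain_reverse]
      exact this.imp fun _ _ hab => hab.symm
    have h2 : ((b :: Z) ++ a :: X').IsChain G.Adj :=
      List.isChain_split.2 ⟨by simpa using hch, hch0.left_of_append⟩
    rw [e]
    exact List.isChain_split.2 ⟨h1, h2⟩
  · rw [List.append_assoc, List.head?_append, List.head?_reverse, ht]; rfl
  · rw [List.getLast?_append_of_ne_nil _ hX]; exact hs
  · grind
  · grind
  · intro t' ht' h1 h2 c hc
    rw [cycConsec_append hX hY] at hc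
    simp only [consec_append, consec_reverse]
    simp only [Junction] at hc
    grind

/-- Insertion of the piece `S` of the cycle between two consecutive vertices of the rest. -/
theorem Linkable.insert_piece {R₁ R₂ S : List V} (h : Linkable G (R₁ ++ R₂ ++ S) H T)
    (hL : IsCyc G (R₁ ++ R₂ ++ S)) (hH : ∀ v ∈ R₁ ++ R₂ ++ S, v ∉ H) {x y u u' a b : V}
    (hx : R₁.head? = some x) (hu : R₁.getLast? = some u) (hu' : R₂.head? = some u')
    (hy : R₂.getLast? = some y) (ha : S.head? = some a) (hb : S.getLast? = some b)
    (hxT : x ∈ T) (hyT : y ∈ T) (huT : u ∉ T) (huT' : u' ∉ T) (hST : ∀ v ∈ S, v ∉ T)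
    (hub : G.Adj u b) (hua : G.Adj u' a) : False := by
  have hR₁ : R₁ ≠ [] := by rintro rfl; simp at hx
  have hR₂ : R₂ ≠ [] := by rintro rfl; simp at hy
  have hS : S ≠ [] := by rintro rfl; simp at ha
  obtain ⟨-, hnd, -⟩ := id hL
  have hch0 := hL.isChain
  have hxy : x ≠ y := by
    rintro rfl
    exact (List.disjoint_of_nodup_append (List.Nodup.of_append_left hnd))
      (List.mem_of_head? hx) (List.mem_of_getLast? hy)
  refine h (R₁ ++ S.reverse ++ R₂) x y ?_ ?_ ?_ ?_ hxT hyT hxy ?_ ?_ ?_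
  · simp only [List.nodup_append, List.nodup_reverse, List.mem_reverse, List.mem_append] at hnd ⊢
    grind
  · have h1 := hch0.left_of_append.left_of_append
    have h2 := hch0.left_of_append.right_of_append
    have h3 : S.reverse.IsChain G.Adj :=
      List.isChain_reverse.2 (hch0.right_of_append.imp fun _ _ hab => hab.symm)
    rw [List.isChain_append, List.isChain_append]
    refine ⟨⟨h1, h3, ?_⟩, h2, ?_⟩
    · simp [hu, hb, hub]
    · rw [List.getLast?_append_of_ne_nil _ (by simpa using hS)]
      simp [ha, hu', hua.symm]
  · rw [List.append_assoc, List.head?_append]; simp [hx]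
  · rw [List.getLast?_append_of_ne_nil _ hR₂]; exact hy
  · grind
  · grind
  · intro t' ht' h1 h2 c hc
    rw [cycConsec_append (by simp [hR₁]) hS, consec_append] at hc
    simp only [consec_append, consec_reverse]
    simp only [Junction, List.getLast?_append_of_ne_nil _ hR₂, List.head?_append] at hc
    have := List.mem_of_getLast? hb
    have := List.mem_of_head? ha
    grind

theorem exists_exit {D : Set V} : ∀ (Q : List V) (d : V), d ∈ D → (∃ v ∈ Q, v ∉ D) →
    ∃ A u t B, d :: Q = A ++ u :: t :: B ∧ u ∈ D ∧ t ∉ D := by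
  intro Q
  induction Q with
  | nil => simp
  | cons q Q ih =>
    intro d hd hv
    by_cases hq : q ∈ D
    · obtain ⟨A, u, t, B, e, hu, ht⟩ := ih q hq (by grind)
      exact ⟨d :: A, u, t, B, by simp [e], hu, ht⟩
    · exact ⟨[], d, q, Q, rfl, hd, hq⟩

theorem exists_two_cycConsec (hL : L.Nodup) (hlen : 3 ≤ L.length) {t : V} (ht : t ∈ L) :
    ∃ a b, a ≠ b ∧ CycConsec L t a ∧ CycConsec L t b := by
  obtain ⟨A, B, rfl⟩ := List.append_of_mem ht
  have hnd : (t :: (B ++ A)).Nodup := by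
    have := List.nodup_append_comm.1 hL
    simpa using this
  have hlen' : 2 ≤ (B ++ A).length := by simp at hlen ⊢; omega
  simp only [cycConsec_comm_append A]
  rw [List.cons_append]
  obtain ⟨a, C, hC⟩ : ∃ a C, B ++ A = a :: C := by
    cases h : B ++ A with
    | nil => simp [h] at hlen'
    | cons a C => exact ⟨a, C, rfl⟩
  rw [hC] at hnd hlen' ⊢
  obtain ⟨C', b, rfl⟩ : ∃ C' b, C = C' ++ [b] := by
    rcases List.eq_nil_or_concat C with rfl | ⟨C', b, rfl⟩
    · simp at hlen'
    · exact ⟨C', b, by simp⟩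
  refine ⟨a, b, by grind, ?_, ?_⟩
  · simp [CycConsec, Consec]
  · rw [CycConsec, consec_append]
    refine Or.inr (Or.inr (Or.inr ⟨?_, rfl⟩))
    rw [← List.cons_append, ← List.cons_append, List.getLast?_concat]

theorem consec_append_cons {A B : List V} {t a : V} (hnd : (A ++ t :: B).Nodup)
    (h : Consec (A ++ t :: B) t a) : A.getLast? = some a ∨ B.head? = some a := by
  rw [consec_append] at h
  rcases h with h | h | h | h
  · have := Consec.mem h
    grind
  · cases B with
    | nil => simp [Consec] at h
    | cons b B =>
      simp only [Consec] at h
      rcases h with h | h | h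
      · simp [h.2]
      · grind
      · have := Consec.mem h
        grind
  · have := List.mem_of_getLast? h.1
    grind
  · exact Or.inl h.1

/-- A vertex `y` joined to every cycle neighbour in `D` of a vertex of `T` may be added to a
linkable set, if `D` is closed outside `T` and met by the cycle often enough. -/
theorem Linkable.insert_vertex (h : Linkable G L H T) (hL : L.Nodup) {D : Set V} {y : V}
    (hyD : y ∈ D) (hD : ∀ v ∈ D, ∀ w, G.Adj v w → w ∉ D → w ∈ T) (hDT : ∀ v ∈ D, v ∉ T)
    (hTL : ∀ v ∈ T, v ∈ L)
    (hyadj : ∀ t ∈ T, ∀ v ∈ D, CycConsec L t v → G.Adj y v)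
    (hmany : ∀ x, ∃ t ∈ T, ∃ t' ∈ T, t ≠ t' ∧ t ≠ x ∧ t' ≠ x ∧ (∃ a ∈ D, CycConsec L t a) ∧
      ∃ a ∈ D, CycConsec L t' a) :
    Linkable G L H (insert y T) := by
  have key : ∀ (P : List V) (x : V), P.Nodup → P.IsChain G.Adj → P.head? = some x →
      P.getLast? = some y → x ∈ T → (∀ v ∈ L, v ∈ P) → (∀ v ∈ P, v ∉ H) →
      (∀ t ∈ T, t ≠ x → t ≠ y → ∀ b, CycConsec L t b → Consec P t b) → False := by
    intro P x hnd hch hx hy hxT hLP hPH hP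
    have hyT : y ∉ T := hDT y hyD
    obtain ⟨t, htT, t', htT', htt, htx, htx', ⟨a, haD, hta⟩, ⟨a', haD', hta'⟩⟩ := hmany x
    have hlen : 3 ≤ L.length := by
      have hn : [t, t', x].Nodup := by grind
      have := (List.subperm_of_subset hn (l₂ := L) (by
        intro v hv
        have : v ∈ T := by grind
        exact hTL v this)).length_le
      simpa using this
    have hty : t ≠ y := fun e => hyT (e ▸ htT)
    have hty' : t' ≠ y := fun e => hyT (e ▸ htT')
    have hcons := hP t htT htx hty a hta
    have hcons' := hP t' htT' htx' hty' a' hta'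
    have hexit : ∃ Q d R, P = Q ++ d :: R ∧ d ∈ D ∧ ∃ v ∈ R, v ∉ D := by
      have aux : ∀ t ∈ T, ∀ t' ∈ T, ∀ a ∈ D, Consec P t a → ∀ A B, P = A ++ t :: B → t' ∈ B →
          ∃ Q d R, P = Q ++ d :: R ∧ d ∈ D ∧ ∃ v ∈ R, v ∉ D := by
        intro t ht t' ht' a ha hc A B e htB
        rw [e] at hc hnd
        rcases consec_append_cons hnd hc with h1 | h1
        · obtain ⟨Q, R, rfl⟩ := List.append_of_mem (List.mem_of_getLast? h1)
          exact ⟨Q, a, R ++ t :: B, by simp [e], ha, t, by simp, fun hd => hDT _ hd ht⟩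
        · obtain ⟨R, rfl⟩ : ∃ R, B = a :: R := by cases B <;> simp_all
          refine ⟨A ++ [t], a, R, by simp [e], ha, t', ?_, fun hd => hDT _ hd ht'⟩
          rcases List.mem_cons.1 htB with rfl | h2
          · exact absurd ht' (hDT _ ha)
          · exact h2
      obtain ⟨A, B, e⟩ := List.append_of_mem (hLP t (hTL t htT))
      by_cases hB : t' ∈ B
      · exact aux t htT t' htT' a haD hcons A B e hB
      · have hA : t' ∈ A := by
          have : t' ∈ P := hLP t' (hTL t' htT')
          grind
        obtain ⟨A', B', rfl⟩ := List.append_of_mem hA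
        exact aux t' htT' t htT a' haD' hcons' A' (B' ++ t :: B) (by simp [e]) (by simp)
    obtain ⟨Q, d, R, e, hd, hR⟩ := hexit
    obtain ⟨A, u, t₀, B, e', hu, ht₀⟩ := exists_exit R d hd hR
    have eP : P = (Q ++ A ++ [u]) ++ t₀ :: B := by simp [e, e']
    have hadj : G.Adj u t₀ := by
      rw [eP, List.isChain_append] at hch
      exact hch.2.2 u (by simp) t₀ (by simp)
    have ht₀T : t₀ ∈ T := hD u hu t₀ hadj ht₀
    have hnd' := hnd
    rw [eP] at hnd'
    have ht₀x : x ≠ t₀ := by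
      rintro rfl
      have : (Q ++ A ++ [u]).head? = some x := by
        rw [eP] at hx
        cases hQ : Q ++ A ++ [u] with
        | nil => simp at hQ
        | cons z R =>
          rw [hQ] at hx
          exact hx
      have := List.mem_of_head? this
      grind
    have ht₀y : t₀ ≠ y := fun e => hyT (e ▸ ht₀T)
    have hlast : (t₀ :: B).getLast? = some y := by
      rw [eP, List.getLast?_append_of_ne_nil _ (by simp)] at hy
      exact hy
    have hyu : G.Adj y u := by
      refine hyadj t₀ ht₀T u hu ?_
      obtain ⟨b, c, hbc, hb, hc⟩ := exists_two_cycConsec hL hlen (hTL _ ht₀T)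
      have hb' := hP t₀ ht₀T ht₀x.symm ht₀y b hb
      have hc' := hP t₀ ht₀T ht₀x.symm ht₀y c hc
      rw [eP] at hb' hc'
      have hb'' := consec_append_cons hnd' hb'
      have hc'' := consec_append_cons hnd' hc'
      simp only [List.getLast?_concat, Option.some.injEq] at hb'' hc''
      grind
    refine h ((Q ++ A ++ [u]) ++ (t₀ :: B).reverse) x t₀ ?_ ?_ ?_ ?_ hxT ht₀T ht₀x ?_ ?_ ?_
    · rw [List.nodup_append] at hnd' ⊢
      exact ⟨hnd'.1, List.nodup_reverse.2 hnd'.2.1, by simpa only [List.mem_reverse] using hnd'.2.2⟩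
    · rw [eP] at hch
      rw [List.isChain_append] at hch ⊢
      refine ⟨hch.1, List.isChain_reverse.2 (hch.2.1.imp fun _ _ hab => hab.symm), ?_⟩
      rw [List.getLast?_concat, List.head?_reverse, hlast]
      simp [hyu.symm]
    · rw [eP] at hx
      simpa using hx
    · rw [List.getLast?_append_of_ne_nil _ (by simp), List.getLast?_reverse]
      rfl
    · intro v hv
      have := hLP v hv
      grind
    · intro v hv
      exact hPH v (by grind)
    · intro t ht h1 h2 b hb
      have h3 := hP t ht h1 (fun e => hyT (e ▸ ht)) b hb
      rw [eP, consec_append] at h3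
      rw [consec_append, consec_reverse]
      simp only [Junction, List.getLast?_concat] at h3
      have : u ∉ T := hDT u hu
      grind
  intro P x z hnd hch hx hz hxT hzT hxz hLP hPH hP
  rcases hxT with rfl | hxT
  · rcases hzT with rfl | hzT
    · exact hxz rfl
    · refine key P.reverse z (by simpa) ?_ (by simpa) (by simpa) hzT (by simpa) (by simpa) ?_
      · exact List.isChain_reverse.2 (hch.imp fun _ _ hab => hab.symm)
      · intro t ht h1 h2 b hb
        rw [consec_reverse]
        exact hP t (Or.inr ht) h2 h1 b hb
  · rcases hzT with rfl | hzT
    · exact key P x hnd hch hx hz hxT hLP hPH fun t ht => hP t (Or.inr ht)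
    · exact h P x z hnd hch hx hz hxT hzT hxz hLP hPH fun t ht => hP t (Or.inr ht)

end Exchange

section Rotation

variable {V : Type*} {G : SimpleGraph V} {L : List V} {H T : Set V}

theorem List.IsRotated.exists_append {L R : List V} (h : L ~r R) :
    ∃ A B, L = A ++ B ∧ R = B ++ A := by
  obtain ⟨n, hn, rfl⟩ := List.isRotated_iff_mod.1 h
  exact ⟨L.take n, L.drop n, by simp, List.rotate_eq_drop_append_take hn⟩

theorem Linkable.isRotated {R : List V} (h : Linkable G L H T) (hR : L ~r R) :
    Linkable G R H T := by
  obtain ⟨A, B, rfl, rfl⟩ := hR.exists_append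
  exact h.comm_append

theorem IsCyc.isRotated {R : List V} (h : IsCyc G L) (hR : L ~r R) : IsCyc G R := by
  obtain ⟨A, B, rfl, rfl⟩ := hR.exists_append
  exact h.comm_append

/-- `b` directly follows `a` in the cyclic list `L`. -/
def CycSucc (L : List V) (a b : V) : Prop :=
  ∃ R, L ~r R ∧ R.head? = some b ∧ R.getLast? = some a

theorem cycSucc_reverse {a b : V} (h : CycSucc L a b) : CycSucc L.reverse b a := by
  obtain ⟨R, hR, h1, h2⟩ := h
  exact ⟨R.reverse, hR.reverse, by simpa, by simpa⟩

theorem cycSucc_of_eq_append {A B : List V} {a b : V} (h : L ~r A ++ a :: B)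
    (hB : B.head? = some b) : CycSucc L a b := by
  refine ⟨B ++ (A ++ [a]), h.trans ?_, ?_, ?_⟩
  · have := List.isRotated_append (l := A ++ [a]) (l' := B)
    simpa using this
  · cases B <;> simp_all
  · rw [← List.append_assoc, List.getLast?_concat]

theorem exists_cycSucc {a : V} (ha : a ∈ L) : ∃ b, CycSucc L a b := by
  obtain ⟨A, B, rfl⟩ := List.append_of_mem ha
  have h : (A ++ a :: B) ~r (B ++ A) ++ [a] := by
    have := List.isRotated_append (l := A ++ [a]) (l' := B)
    simpa using this
  obtain ⟨b, R, hR⟩ : ∃ b R, (B ++ A) ++ [a] = b :: R := by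
    cases h : (B ++ A) ++ [a] with
    | nil => simp at h
    | cons b R => exact ⟨b, R, rfl⟩
  exact ⟨b, (B ++ A) ++ [a], h, by simp [hR], by simp⟩

theorem CycSucc.unique {a b c : V} (hL : L.Nodup) (hb : CycSucc L a b) (hc : CycSucc L a c) :
    b = c := by
  obtain ⟨R, hR, h1, h2⟩ := hb
  obtain ⟨R', hR', h3, h4⟩ := hc
  have hnd : R.Nodup := hR.nodup_iff.1 hL
  obtain ⟨A, B, rfl, rfl⟩ := (hR.symm.trans hR').exists_append
  rcases eq_or_ne A [] with rfl | hA
  · simp_all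
  rcases eq_or_ne B [] with rfl | hB
  · simp_all
  rw [List.getLast?_append_of_ne_nil _ hB] at h2
  rw [List.getLast?_append_of_ne_nil _ hA] at h4
  exact absurd (List.mem_of_getLast? h2)
    ((List.disjoint_of_nodup_append hnd) (List.mem_of_getLast? h4))

theorem CycSucc.unique_left {a b c : V} (hL : L.Nodup) (hb : CycSucc L b a)
    (hc : CycSucc L c a) : b = c :=
  (cycSucc_reverse hb).unique (by simpa using hL) (cycSucc_reverse hc)

theorem CycSucc.cycConsec {a b : V} (h : CycSucc L a b) : CycConsec L a b := by
  obtain ⟨R, hR, h1, h2⟩ := h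
  obtain ⟨A, B, rfl, rfl⟩ := hR.exists_append
  rw [cycConsec_comm_append, CycConsec, consec_append]
  exact Or.inr (Or.inr (Or.inl ⟨h2, h1⟩))

theorem CycConsec.cycSucc {a b : V} (hL : L.Nodup) (ha : a ∈ L) (h : CycConsec L a b) :
    CycSucc L a b ∨ CycSucc L b a := by
  obtain ⟨A, B, rfl⟩ := List.append_of_mem ha
  have hr : (A ++ a :: B) ~r [a] ++ (B ++ A) := by
    have := List.isRotated_append (l := A) (l' := a :: B)
    simpa using this
  rw [cycConsec_comm_append, List.cons_append] at h
  have hnd := hr.nodup_iff.1 hL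
  have hr' := hr.trans List.isRotated_append
  generalize B ++ A = C at *
  rcases eq_or_ne C [] with rfl | hC
  · have : b = a := by simpa [CycConsec, Consec] using h
    subst this
    exact Or.inl ⟨[b], by simpa using hr, rfl, rfl⟩
  have haC : a ∉ C := by simp at hnd; exact hnd.1
  rw [← List.singleton_append, cycConsec_append (by simp) hC] at h
  rcases h with h | h | h | h | h | h
  · simp [Consec] at h
  · exact absurd (Consec.mem h) haC
  · refine Or.inl ⟨C ++ [a], hr', ?_, by simp⟩
    have := h.2
    cases C <;> simp_all
  · exact absurd (List.mem_of_head? h.2) haC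
  · exact absurd (List.mem_of_getLast? h.1) haC
  · refine Or.inr ⟨[a] ++ C, hr, rfl, ?_⟩
    rw [List.getLast?_append_of_ne_nil _ hC]
    exact h.1

theorem Linkable.exchange_cycSucc {Z : List V} (h : Linkable G L H T) (hL : IsCyc G L)
    (hH : ∀ v ∈ L, v ∉ H) {a s b t : V} (ha : CycSucc L t a) (hb : CycSucc L s b) (hst : s ≠ t)
    (hsT : s ∈ T) (htT : t ∈ T) (hsL : s ∈ L)
    (haT : a ∉ T) (hbT : b ∉ T) (hZ : Z.Nodup) (hZL : ∀ v ∈ Z, v ∉ L) (hZH : ∀ v ∈ Z, v ∉ H)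
    (hch : (b :: (Z ++ [a])).IsChain G.Adj) : False := by
  obtain ⟨R, hR, h1, h2⟩ := ha
  obtain ⟨A, B, rfl⟩ := List.append_of_mem (hR.mem_iff.1 hsL)
  have hB : B ≠ [] := by
    rintro rfl
    simp at h2
    exact hst h2
  obtain ⟨b', B', rfl⟩ := List.exists_cons_of_ne_nil hB
  obtain rfl : b = b' := hb.unique hL.2.1 (cycSucc_of_eq_append hR rfl)
  have e : A ++ s :: b :: B' = (A ++ [s]) ++ b :: B' := by simp
  rw [e] at hR
  refine (h.isRotated hR).exchange (hL.isRotated hR) (fun v hv => hH v (hR.mem_iff.2 hv))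
    (a := a) (s := s) (b := b) (t := t) ?_ (by simp) rfl ?_ hsT htT haT hbT hZ
    (fun v hv => fun hv' => hZL v hv (hR.mem_iff.2 hv')) hZH hch
  · cases A <;> simp_all
  · rw [e, List.getLast?_append_of_ne_nil _ (by simp)] at h2
    exact h2

theorem Linkable.not_mem_of_cycSucc (h : Linkable G L H T) (hL : IsCyc G L)
    (hH : ∀ v ∈ L, v ∉ H) {a t : V} (ha : CycSucc L t a) (hta : t ≠ a) (htT : t ∈ T) : a ∉ T := by
  obtain ⟨R, hR, h1, h2⟩ := ha
  intro haT
  exact (h.isRotated hR).not_ends (hL.isRotated hR) (fun v hv => hH v (hR.mem_iff.2 hv)) h1 h2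
    hta.symm haT htT

theorem subset_or_disjoint_of_isChain {D : Set V}
    (hD : ∀ v ∈ D, ∀ w, G.Adj v w → w ∉ D → w ∈ T) :
    ∀ S : List V, S.IsChain G.Adj → (∀ v ∈ S, v ∉ T) → (∀ v ∈ S, v ∈ D) ∨ ∀ v ∈ S, v ∉ D := by
  intro S
  induction S with
  | nil => simp
  | cons s S ih =>
    intro hc hT
    cases S with
    | nil => simpa using em _
    | cons r S =>
      rw [List.isChain_cons_cons] at hc
      have hs := hD s
      have hr := hD r
      rcases ih hc.2 (fun v hv => hT v (List.mem_cons_of_mem _ hv)) with h | h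
      · refine Or.inl ?_
        by_contra! hcon
        have := hr (h r (by simp)) s hc.1.symm (by grind)
        exact hT s (by simp) this
      · refine Or.inr ?_
        by_contra! hcon
        have := hs (by grind) r hc.1 (h r (by simp))
        exact hT r (by simp) this

theorem exists_last_mem {T : Set V} : ∀ R : List V, (∃ v ∈ R, v ∈ T) →
    ∃ A t S, R = A ++ t :: S ∧ t ∈ T ∧ ∀ v ∈ S, v ∉ T := by
  intro R
  induction R with
  | nil => simp
  | cons r R ih =>
    intro h
    by_cases hR : ∃ v ∈ R, v ∈ T
    · obtain ⟨A, t, S, rfl, h1, h2⟩ := ih hR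
      exact ⟨r :: A, t, S, rfl, h1, h2⟩
    · refine ⟨[], r, R, rfl, ?_, ?_⟩ <;> grind

theorem exists_first_mem {T : Set V} : ∀ R : List V, (∃ v ∈ R, v ∈ T) →
    ∃ A t S, R = A ++ t :: S ∧ t ∈ T ∧ ∀ v ∈ A, v ∉ T := by
  intro R
  induction R with
  | nil => simp
  | cons r R ih =>
    intro h
    by_cases hr : r ∈ T
    · exact ⟨[], r, R, rfl, hr, by simp⟩
    · obtain ⟨A, t, S, rfl, h1, h2⟩ := ih (by grind)
      refine ⟨r :: A, t, S, rfl, h1, ?_⟩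
      grind

end Rotation

section Core

variable {V : Type*} {G : SimpleGraph V} {L : List V} {H T D X Y : Set V}

/-- If some cycle predecessor of a vertex of `T` lies in `Y`, while all the cycle successors lie
in `X`, two pieces of the cycle inside `D` can be merged. -/
theorem Linkable.merge_pieces (h : Linkable G L H T) (hL : IsCyc G L) (hLH : ∀ v ∈ L, v ∉ H)
    (hTL : ∀ v ∈ T, v ∈ L) (hD : ∀ v ∈ D, ∀ w, G.Adj v w → w ∉ D → w ∈ T)
    (hDT : ∀ v ∈ D, v ∉ T) (hXY : X ∪ Y = D) (hdisj : Disjoint X Y)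
    (hjoin : ∀ x ∈ X, ∀ y ∈ Y, G.Adj x y)
    (hsucc : ∀ t ∈ T, ∀ v ∈ D, CycSucc L t v → v ∈ X)
    (hpred : ∀ t ∈ T, ∀ v ∈ D, CycSucc L v t → v ∈ Y)
    (hmany : ∀ x, ∃ t ∈ T, t ≠ x ∧ ∃ a ∈ D, CycSucc L t a)
    {t₂ w : V} (ht₂ : t₂ ∈ T) (hw : w ∈ Y) (hwt : CycSucc L w t₂) : False := by
  have hYD : ∀ v ∈ Y, v ∈ D := fun v hv => hXY ▸ Or.inr hv
  obtain ⟨R, hR, hR1, hR2⟩ := hwt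
  obtain ⟨R₀, t₁, S, rfl, ht₁, hST⟩ := exists_last_mem R ⟨t₂, List.mem_of_head? hR1, ht₂⟩
  have hS : S ≠ [] := by
    rintro rfl
    rw [List.getLast?_concat, Option.some.injEq] at hR2
    exact hDT _ (hYD _ hw) (hR2 ▸ ht₁)
  have hSw : S.getLast? = some w := by
    rwa [List.getLast?_append_of_ne_nil _ (by simp), ← List.singleton_append,
      List.getLast?_append_of_ne_nil _ hS] at hR2
  have hRc := hL.isRotated hR
  have hRch := hRc.isChain
  have hSD : ∀ v ∈ S, v ∈ D := by
    have hc : S.IsChain G.Adj := by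
      have := hRch.right_of_append
      rw [← List.singleton_append] at this
      exact this.right_of_append
    refine (subset_or_disjoint_of_isChain hD S hc hST).resolve_right fun hcon => ?_
    exact hcon w (List.mem_of_getLast? hSw) (hYD _ hw)
  obtain ⟨a, S', rfl⟩ := List.exists_cons_of_ne_nil hS
  have ha : a ∈ X := hsucc t₁ ht₁ a (hSD a (by simp)) (cycSucc_of_eq_append hR rfl)
  obtain ⟨t₃, ht₃, h31, v, hv, ht₃v⟩ := hmany t₁
  have ht₃R : t₃ ∈ R₀ := by
    have := hR.mem_iff.1 (hTL _ ht₃)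
    grind
  obtain ⟨A, B, rfl⟩ := List.append_of_mem ht₃R
  obtain ⟨E, t₄, F, hE, ht₄, hET⟩ := exists_first_mem (B ++ [t₁]) ⟨t₁, by simp, ht₁⟩
  have e1 : (A ++ t₃ :: B) ++ t₁ :: a :: S' = A ++ t₃ :: (E ++ t₄ :: F ++ a :: S') := by
    rw [← hE]; simp
  rw [e1] at hR hRc hRch hR1
  have hE0 : E ≠ [] := by
    rintro rfl
    have h1 : CycSucc L t₃ t₄ := cycSucc_of_eq_append hR rfl
    have := ht₃v.unique hL.2.1 h1
    exact hDT v hv (this ▸ ht₄)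
  obtain ⟨b, E', rfl⟩ := List.exists_cons_of_ne_nil hE0
  obtain rfl : v = b := ht₃v.unique hL.2.1 (cycSucc_of_eq_append hR rfl)
  have hvX : v ∈ X := hsucc t₃ ht₃ v hv ht₃v
  have hED : ∀ u ∈ v :: E', u ∈ D := by
    have hc : (v :: E').IsChain G.Adj := by
      have := hRch.right_of_append
      rw [← List.singleton_append] at this
      exact this.right_of_append.left_of_append.left_of_append
    refine (subset_or_disjoint_of_isChain hD _ hc hET).resolve_right fun hcon => ?_
    exact hcon v (by simp) hv
  obtain ⟨E₀, z, hz⟩ : ∃ E₀ z, v :: E' = E₀ ++ [z] := by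
    rcases List.eq_nil_or_concat (v :: E') with h0 | ⟨E₀, z, h0⟩
    · simp at h0
    · exact ⟨E₀, z, by simpa using h0⟩
  have hzE : z ∈ v :: E' := by simp [hz]
  have hzY : z ∈ Y := by
    refine hpred t₄ ht₄ z (hED z hzE) ?_
    refine cycSucc_of_eq_append (A := A ++ t₃ :: E₀) (B := t₄ :: F ++ a :: S') ?_ rfl
    rw [hz] at hR
    simpa using hR
  have hzX : z ∉ X := fun h => Set.disjoint_left.1 hdisj h hzY
  have hzE' : z ∈ E' := by
    rcases List.mem_cons.1 hzE with rfl | h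
    · exact absurd hvX hzX
    · exact h
  obtain ⟨E₁, u, u', E₂, he, hu, hu'⟩ := exists_exit E' v hvX ⟨z, hzE', hzX⟩
  rw [he] at hED hR hRc hRch hR1 hE hET
  have hu'Y : u' ∈ Y := by
    have : u' ∈ D := hED u' (by simp)
    rw [← hXY] at this
    exact this.resolve_left hu'
  have e2 : A ++ t₃ :: (E₁ ++ u :: u' :: E₂ ++ t₄ :: F ++ a :: S') =
      (A ++ t₃ :: E₁ ++ [u]) ++ (u' :: E₂ ++ t₄ :: F) ++ a :: S' := by simp
  rw [e2] at hR hRc hR1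
  refine (h.isRotated hR).insert_piece hRc (fun v hv => hLH v (hR.mem_iff.2 hv)) (x := t₂) (u := u)
    (u' := u') (y := t₁) (a := a) (b := w) ?_ List.getLast?_concat rfl ?_ rfl hSw ht₂ ht₁
    (hET u (by simp)) (hET u' (by simp)) hST (hjoin u hu w hw) (hjoin a ha u' hu'Y).symm
  · cases A <;> simp_all
  · have h1 : (E₁ ++ u :: u' :: E₂ ++ t₄ :: F).getLast? = some t₁ := by rw [← hE]; simp
    have e3 : E₁ ++ u :: u' :: E₂ ++ t₄ :: F = (E₁ ++ [u]) ++ (u' :: E₂ ++ t₄ :: F) := by simp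
    rwa [e3, List.getLast?_append_of_ne_nil _ (by simp)] at h1

theorem Linkable.nonadj_cycSucc (h : Linkable G L H T) (hL : IsCyc G L) (hLH : ∀ v ∈ L, v ∉ H)
    (hTL : ∀ v ∈ T, v ∈ L) {s t a b : V} (hs : s ∈ T) (ht : t ∈ T) (hst : s ≠ t)
    (ha : CycSucc L t a) (hb : CycSucc L s b) (haT : a ∉ T) (hbT : b ∉ T) : ¬ G.Adj b a :=
  fun hab => h.exchange_cycSucc (Z := []) hL hLH ha hb hst hs ht (hTL s hs) haT hbT (by simp)
    (by simp) (by simp) (by simpa using hab)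

/-- In a join, the cycle successors of the vertices of a linkable set are on one side. -/
theorem Linkable.cycSucc_mem (h : Linkable G L H T) (hL : IsCyc G L) (hLH : ∀ v ∈ L, v ∉ H)
    (hTL : ∀ v ∈ T, v ∈ L) (hDT : ∀ v ∈ D, v ∉ T) (hXY : X ∪ Y = D)
    (hjoin : ∀ x ∈ X, ∀ y ∈ Y, G.Adj x y) {t₀ a₀ : V} (ht₀ : t₀ ∈ T) (ha₀ : a₀ ∈ X)
    (h₀ : CycSucc L t₀ a₀) : ∀ t ∈ T, ∀ v ∈ D, CycSucc L t v → v ∈ X := by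
  intro t ht v hv htv
  have ha₀T : a₀ ∉ T := hDT a₀ (hXY ▸ Or.inl ha₀)
  by_cases htt : t = t₀
  · subst htt
    rwa [htv.unique hL.2.1 h₀]
  have hv' := hv
  rw [← hXY] at hv'
  refine hv'.resolve_right fun hvY => ?_
  exact h.nonadj_cycSucc hL hLH hTL ht₀ ht (Ne.symm htt) htv h₀ (hDT v hv) ha₀T
    (hjoin a₀ ha₀ v hvY)

theorem Linkable.false_of_join (h : Linkable G L H T) (hL : IsCyc G L) (hLH : ∀ v ∈ L, v ∉ H)
    (hTL : ∀ v ∈ T, v ∈ L) (hmax : ∀ y ∈ L, y ∉ T → ¬ Linkable G L H (insert y T))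
    (hD : ∀ v ∈ D, ∀ w, G.Adj v w → w ∉ D → w ∈ T) (hDT : ∀ v ∈ D, v ∉ T)
    (hDH : ∀ v ∈ D, v ∉ H) (hXY : X ∪ Y = D) (hX : X.Nonempty) (hY : Y.Nonempty)
    (hdisj : Disjoint X Y) (hjoin : ∀ x ∈ X, ∀ y ∈ Y, G.Adj x y)
    (hmany : ∀ x, ∃ t ∈ T, ∃ t' ∈ T, t ≠ t' ∧ t ≠ x ∧ t' ≠ x ∧ (∃ a ∈ D, CycSucc L t a) ∧
      ∃ a ∈ D, CycSucc L t' a) : False := by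
  wlog hsucc : ∃ t₀ ∈ T, ∃ a₀ ∈ X, CycSucc L t₀ a₀ generalizing X Y
  · refine this (by rwa [Set.union_comm]) hY hX hdisj.symm
      (fun x hx y hy => (hjoin y hy x hx).symm) ?_
    obtain ⟨t, ht, -, -, -, -, -, ⟨a, ha, hta⟩, -⟩ := hmany hX.some
    refine ⟨t, ht, a, ?_, hta⟩
    rw [← hXY] at ha
    exact ha.resolve_left fun haX => hsucc ⟨t, ht, a, haX, hta⟩
  obtain ⟨t₀, ht₀, a₀, ha₀, h₀⟩ := hsucc
  have hsucc := h.cycSucc_mem hL hLH hTL hDT hXY hjoin ht₀ ha₀ h₀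
  have hXD : ∀ v ∈ X, v ∈ D := fun v hv => hXY ▸ Or.inl hv
  have hYD : ∀ v ∈ Y, v ∈ D := fun v hv => hXY ▸ Or.inr hv
  by_cases hpred : ∀ t ∈ T, ∀ v ∈ D, CycSucc L v t → v ∈ X
  · obtain ⟨y, hy⟩ := hY
    have hyT := hDT y (hYD y hy)
    by_cases hyL : y ∈ L
    · refine hmax y hyL hyT (h.insert_vertex hL.2.1 (hYD y hy) hD hDT hTL ?_ ?_)
      · intro t ht v hv htv
        rcases htv.cycSucc hL.2.1 (hTL t ht) with h1 | h1
        · exact (hjoin v (hsucc t ht v hv h1) y hy).symm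
        · exact (hjoin v (hpred t ht v hv h1) y hy).symm
      · intro x
        obtain ⟨t, ht, t', ht', h1, h2, h3, ⟨a, ha, hta⟩, ⟨a', ha', hta'⟩⟩ := hmany x
        exact ⟨t, ht, t', ht', h1, h2, h3, ⟨a, ha, hta.cycConsec⟩, ⟨a', ha', hta'.cycConsec⟩⟩
    · obtain ⟨t, ht, t', ht', h1, -, -, ⟨a, ha, hta⟩, ⟨a', ha', hta'⟩⟩ := hmany y
      refine h.exchange_cycSucc (Z := [y]) hL hLH hta hta' h1.symm ht' ht (hTL t' ht')
        (hDT a ha) (hDT a' ha') (by simp) (by simpa) (by simpa using hDH y (hYD y hy)) ?_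
      have h2 := hjoin a (hsucc t ht a ha hta) y hy
      have h3 := hjoin a' (hsucc t' ht' a' ha' hta') y hy
      simpa using ⟨h3, h2.symm⟩
  · push Not at hpred
    obtain ⟨t₂, ht₂, w, hw, hwt, hwX⟩ := hpred
    have hwY : w ∈ Y := by
      rw [← hXY] at hw
      exact hw.resolve_left hwX
    refine h.merge_pieces hL hLH hTL hD hDT hXY hdisj hjoin hsucc ?_ ?_ ht₂ hwY hwt
    · intro t ht v hv hvt
      exact h.reverse.cycSucc_mem hL.reverse (by simpa) (by simpa) hDT
        (by rwa [Set.union_comm]) (fun x hx y hy => (hjoin y hy x hx).symm) ht₂ hwY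
        (cycSucc_reverse hwt) t ht v hv (cycSucc_reverse hvt)
    · intro x
      obtain ⟨t, ht, -, -, -, h2, -, h3, -⟩ := hmany x
      exact ⟨t, ht, h2, h3⟩

end Core

section Cograph

variable {V : Type*} {G : SimpleGraph V}

/-- No four vertices of `D` induce a path. -/
def NoP4 (G : SimpleGraph V) (D : Set V) : Prop :=
  ∀ a ∈ D, ∀ b ∈ D, ∀ c ∈ D, ∀ d ∈ D, G.Adj a b → G.Adj b c → G.Adj c d →
    ¬ G.Adj a c → ¬ G.Adj a d → ¬ G.Adj b d → False

/-- `D` has a partition into two nonempty parts without edges between them. -/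
def Splits (G : SimpleGraph V) (D : Set V) : Prop :=
  ∃ X Y : Set V, X ∪ Y = D ∧ X.Nonempty ∧ Y.Nonempty ∧ Disjoint X Y ∧
    ∀ x ∈ X, ∀ y ∈ Y, ¬ G.Adj x y

theorem NoP4.compl {D : Set V} (h : NoP4 G D) : NoP4 Gᶜ D := by
  intro a ha b hb c hc d hd h1 h2 h3 h4 h5 h6
  simp only [SimpleGraph.compl_adj, not_and, not_not] at h1 h2 h3 h4 h5 h6
  have hac : a ≠ c := by
    rintro rfl
    exact h3.2 (h5 h3.1)
  have had : a ≠ d := by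
    rintro rfl
    exact h3.2 (h4 hac).symm
  have hbd : b ≠ d := by
    rintro rfl
    exact h1.2 (h5 had)
  exact h c hc a ha d hd b hb (h4 hac).symm (h5 had) (h6 hbd).symm
    (fun e => h3.2 e) (fun e => h2.2 e.symm) (fun e => h1.2 e)

theorem Splits.insert {D : Set V} {v : V} (hv : v ∉ D) (h : NoP4 G (insert v D))
    (hs : Splits G D) : Splits G (insert v D) ∨ Splits Gᶜ (insert v D) := by
  obtain ⟨X, Y, rfl, hX, hY, hdisj, hXY⟩ := hs
  by_cases hM : ∀ x ∈ X ∪ Y, G.Adj v x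
  · refine Or.inr ⟨{v}, X ∪ Y, rfl, by simp, hX.mono Set.subset_union_left, by simpa using hv, ?_⟩
    simpa using fun x hx _ => hM x hx
  push Not at hM
  wlog hm : ∃ m ∈ X, ¬ G.Adj v m generalizing X Y
  · have e := Set.union_comm X Y
    have := this Y X (e ▸ hv) (e ▸ h) hY hX hdisj.symm
      (fun x hx y hy hxy => hXY y hy x hx hxy.symm) (e ▸ hM) (by grind)
    rwa [Set.union_comm] at this
  obtain ⟨m, hm, hvm⟩ := hm
  left
  by_cases hNY : ∃ c ∈ Y, G.Adj v c
  · obtain ⟨c, hc, hvc⟩ := hNY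
    refine ⟨{x ∈ X | ¬ G.Adj v x}, Insert.insert v ({x ∈ X | G.Adj v x} ∪ Y), ?_, ⟨m, hm, hvm⟩,
      ⟨v, by simp⟩, ?_, ?_⟩
    · ext x
      by_cases hx : G.Adj v x <;> simp [hx]
    · rw [Set.disjoint_left]
      rintro x ⟨hx, hvx⟩ (rfl | hx' | hx')
      · exact hv (Or.inl hx)
      · exact hvx hx'.2
      · exact Set.disjoint_left.1 hdisj hx hx'
    · rintro x ⟨hx, hvx⟩ y (rfl | hy | hy) hxy
      · exact hvx hxy.symm
      · exact h c (by simp [hc]) v (by simp) y (by simp [hy.1]) x (by simp [hx]) hvc.symm hy.2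
          hxy.symm (fun e => hXY y hy.1 c hc e.symm) (fun e => hXY x hx c hc e.symm) hvx
      · exact hXY x hx y hy hxy
  · push Not at hNY
    refine ⟨Insert.insert v X, Y, by rw [Set.insert_union], by simp, hY, ?_, ?_⟩
    · rw [Set.disjoint_insert_left]
      exact ⟨fun h => hv (Or.inr h), hdisj⟩
    · rintro x (rfl | hx) y hy
      · exact hNY y hy
      · exact hXY x hx y hy

theorem NoP4.splits_or_splits_compl (D : Finset V) :
    NoP4 G D → 2 ≤ D.card → Splits G D ∨ Splits Gᶜ D := by
  classical
  induction D using Finset.induction_on with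
  | empty => simp
  | insert v D hv ih =>
    intro h hcard
    rw [Finset.coe_insert] at h ⊢
    rw [Finset.card_insert_of_notMem hv] at hcard
    have hv' : v ∉ (D : Set V) := by simpa
    by_cases h2 : 2 ≤ D.card
    · have hD : NoP4 G (D : Set V) := by
        intro a ha b hb c hc d hd
        exact h a (Or.inr ha) b (Or.inr hb) c (Or.inr hc) d (Or.inr hd)
      rcases ih hD h2 with h3 | h3
      · exact h3.insert hv' h
      · have := h3.insert hv' h.compl
        rw [compl_compl] at this
        exact this.symm
    · obtain ⟨w, rfl⟩ := Finset.card_eq_one.1 (show D.card = 1 by omega)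
      have hvw : v ≠ w := by simpa using hv
      by_cases hadj : G.Adj v w
      · exact Or.inr ⟨{v}, {w}, by simp [Set.pair_comm], by simp, by simp, by simpa using hvw,
          by simpa using fun _ => hadj⟩
      · exact Or.inl ⟨{v}, {w}, by simp [Set.pair_comm], by simp, by simp, by simpa using hvw,
          by simpa using hadj⟩

end Cograph

theorem P4P1Free.noP4 {V : Type*} {G : SimpleGraph V} (hfree : P4P1Free G) {D : Set V} {e : V}
    (he : e ∉ D) (hD : ∀ v ∈ D, ¬ G.Adj e v) : NoP4 G D := by
  intro a ha b hb c hc d hd hab hbc hcd hac had hbd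
  have hea := hD a ha
  have heb := hD b hb
  have hec := hD c hc
  have hed := hD d hd
  have hrel : ∀ i j, G.Adj ((![a, b, c, d, e] : Fin 5 → V) i) ((![a, b, c, d, e] : Fin 5 → V) j) ↔
      P4P1.Adj i j := by
    intro i j
    fin_cases i <;> fin_cases j <;> simp [P4P1, *, hab.symm, hbc.symm, hcd.symm] <;>
      rw [G.adj_comm] <;> assumption
  have hac' : a ≠ c := fun h => had (h ▸ hcd)
  have had' : a ≠ d := fun h => hac (h ▸ hcd.symm)
  have hbd' : b ≠ d := fun h => had (h ▸ hab)
  have hae : a ≠ e := fun h => he (h ▸ ha)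
  have hbe : b ≠ e := fun h => he (h ▸ hb)
  have hce : c ≠ e := fun h => he (h ▸ hc)
  have hde : d ≠ e := fun h => he (h ▸ hd)
  have hinj : Function.Injective (![a, b, c, d, e] : Fin 5 → V) := by
    intro i j
    fin_cases i <;> fin_cases j <;>
      simp [*, hab.ne, hbc.ne, hcd.ne, hab.ne', hbc.ne', hcd.ne', hac'.symm, had'.symm, hbd'.symm,
        hae.symm, hbe.symm, hce.symm, hde.symm]
  exact hfree.false ⟨⟨_, hinj⟩, hrel _ _⟩

section Spanning

variable {V : Type*} {G : SimpleGraph V}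

/-- The vertex set of a component of `G - T`. -/
def compSet (T : Set V) (c : (G.induce Tᶜ).ConnectedComponent) : Set V :=
  {v | ∃ hv : v ∈ Tᶜ, (G.induce Tᶜ).connectedComponentMk ⟨v, hv⟩ = c}

theorem mem_of_adj_compSet {T : Set V} {c : (G.induce Tᶜ).ConnectedComponent} {v w : V}
    (hv : v ∈ compSet T c) (hvw : G.Adj v w) (hw : w ∉ compSet T c) : w ∈ T := by
  obtain ⟨hvT, rfl⟩ := hv
  by_contra hwT
  refine hw ⟨hwT, ?_⟩
  rw [SimpleGraph.ConnectedComponent.eq]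
  exact (SimpleGraph.Adj.reachable (by simpa using hvw.symm))

theorem compSet_subset {T X : Set V} {c : (G.induce Tᶜ).ConnectedComponent} {v : V}
    (hv : v ∈ compSet T c) (hvX : v ∈ X)
    (hX : ∀ u ∈ X, ∀ w, w ∉ T → G.Adj u w → w ∈ X) : compSet T c ⊆ X := by
  rintro w ⟨hwT, hw⟩
  obtain ⟨hvT, rfl⟩ := hv
  rw [SimpleGraph.ConnectedComponent.eq] at hw
  obtain ⟨p⟩ := hw.symm
  have key : ∀ (a b : (Tᶜ : Set V)) (_ : (G.induce Tᶜ).Walk a b), (a : V) ∈ X → (b : V) ∈ X := by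
    intro a b p
    induction p with
    | nil => exact id
    | @cons u v w h p ih => exact fun ha => ih (hX u ha v ((Set.mem_compl_iff _ _).1 v.2) (by simpa using h))
  exact key _ _ p hvX

theorem not_splits_compSet {T : Set V} (c : (G.induce Tᶜ).ConnectedComponent) :
    ¬ Splits G (compSet T c) := by
  rintro ⟨X, Y, hXY, ⟨x, hx⟩, ⟨y, hy⟩, hdisj, hno⟩
  have hxc : x ∈ compSet T c := hXY ▸ Or.inl hx
  have hsub := compSet_subset (X := X) hxc hx ?_
  · exact Set.disjoint_left.1 hdisj (hsub (hXY ▸ Or.inr hy)) hy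
  intro u hu w hw huw
  by_contra hwX
  have huc : u ∈ compSet T c := hXY ▸ Or.inl hu
  by_cases hwc : w ∈ compSet T c
  · rw [← hXY] at hwc
    exact hno u hu w (hwc.resolve_left hwX) huw
  · exact hw (mem_of_adj_compSet huc huw hwc)

theorem exists_path_compSet {T : Set V} {c : (G.induce Tᶜ).ConnectedComponent} {v w : V}
    (hv : v ∈ compSet T c) (hw : w ∈ compSet T c) :
    ∃ Q : List V, Q.Nodup ∧ Q.IsChain G.Adj ∧ Q.head? = some v ∧ Q.getLast? = some w ∧
      ∀ u ∈ Q, u ∈ compSet T c := by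
  classical
  obtain ⟨hvT, rfl⟩ := hv
  obtain ⟨hwT, hw⟩ := hw
  rw [SimpleGraph.ConnectedComponent.eq] at hw
  obtain ⟨p, hp⟩ := hw.symm.exists_isPath
  refine ⟨p.support.map Subtype.val, hp.support_nodup.map Subtype.val_injective, ?_, ?_, ?_, ?_⟩
  · rw [List.isChain_map]
    exact p.isChain_adj_support.imp fun _ _ h => by simpa using h
  · cases p <;> simp
  · rw [List.getLast?_map, List.getLast?_eq_getLast_of_ne_nil p.support_ne_nil]
    simp
  · intro u hu
    obtain ⟨z, hz, rfl⟩ := List.mem_map.1 hu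
    refine ⟨z.2, ?_⟩
    rw [SimpleGraph.ConnectedComponent.eq]
    exact (p.takeUntil z hz).reachable.symm

end Spanning

section Longest

variable {V : Type*} {G : SimpleGraph V} {L : List V}

theorem IsCyc.append {P Q : List V} {x y v w : V} (hP : P.Nodup) (hPc : P.IsChain G.Adj)
    (hx : P.head? = some x) (hy : P.getLast? = some y) (hQ : Q.Nodup) (hQc : Q.IsChain G.Adj)
    (hv : Q.head? = some v) (hw : Q.getLast? = some w) (hyv : G.Adj y v) (hwx : G.Adj w x)
    (hPQ : ∀ u ∈ P, u ∉ Q) : IsCyc G (P ++ Q) := by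
  have hP0 : P ≠ [] := by rintro rfl; simp at hx
  have hQ0 : Q ≠ [] := by rintro rfl; simp at hv
  have hc : (P ++ Q).IsChain G.Adj := by
    rw [List.isChain_append]
    refine ⟨hPc, hQc, ?_⟩
    simp [hy, hv, hyv]
  refine ⟨by simp [hP0], ?_, ?_⟩
  · rw [List.nodup_append]
    exact ⟨hP, hQ, fun u hu z hz e => hPQ u hu (e ▸ hz)⟩
  · rw [List.isChain_append]
    refine ⟨hc, hc, ?_⟩
    rw [List.getLast?_append_of_ne_nil _ hQ0, hw]
    have : (P ++ Q).head? = some x := by rw [List.head?_append, hx]; rfl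
    simp [this, hwx]

/-- For a longest cycle, the attachments of a component of the rest form a linkable set. -/
theorem linkable_of_longest (hL : IsCyc G L) (hmax : ∀ L', IsCyc G L' → L'.length ≤ L.length)
    (c : (G.induce {v | v ∈ L}ᶜ).ConnectedComponent) :
    Linkable G L (compSet _ c) {t | t ∈ L ∧ ∃ v ∈ compSet _ c, G.Adj v t} := by
  rintro P x y hP hPc hx hy ⟨-, v, hv, hvx⟩ ⟨-, w, hw, hwy⟩ - hLP hPH -
  obtain ⟨Q, hQ, hQc, hQw, hQv, hQH⟩ := exists_path_compSet hw hv
  have hcyc := IsCyc.append hP hPc hx hy hQ hQc hQw hQv hwy.symm hvx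
    fun u hu hu' => hPH u hu (hQH u hu')
  have h1 := hmax _ hcyc
  have h2 : L.length ≤ P.length := (List.subperm_of_subset hL.2.1 hLP).length_le
  have h3 : 0 < Q.length := List.length_pos_iff.2 (by rintro rfl; simp at hQw)
  rw [List.length_append] at h1
  omega

theorem exists_three_of_tough [Finite V] (htough : Tough 23 G) {T : Set V}
    (h2 : 2 ≤ ncomps G T) (f : V → V) (hf : ∀ t ∈ T, f t ∉ T) :
    ∃ c : (G.induce Tᶜ).ConnectedComponent, ∃ t₁ ∈ T, ∃ t₂ ∈ T, ∃ t₃ ∈ T,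
      t₁ ≠ t₂ ∧ t₁ ≠ t₃ ∧ t₂ ≠ t₃ ∧ f t₁ ∈ compSet T c ∧ f t₂ ∈ compSet T c ∧
        f t₃ ∈ compSet T c := by
  classical
  have := Fintype.ofFinite V
  have := Fintype.ofFinite (G.induce Tᶜ).ConnectedComponent
  have := Fintype.ofFinite T
  have h23 := htough T h2
  let g : T → (G.induce Tᶜ).ConnectedComponent :=
    fun t => (G.induce Tᶜ).connectedComponentMk ⟨f t, hf t t.2⟩
  have hcard : Fintype.card (G.induce Tᶜ).ConnectedComponent * 2 < Fintype.card T := by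
    rw [← Nat.card_eq_fintype_card, ← Nat.card_eq_fintype_card, Nat.card_coe_set_eq]
    have h3 : 23 * ncomps G T ≤ T.ncard := by exact_mod_cast h23
    rw [ncomps] at h2 h3
    omega
  obtain ⟨c, hc⟩ := Fintype.exists_lt_card_fiber_of_mul_lt_card g hcard
  obtain ⟨t₁, h1, t₂, h2, t₃, h3, h12, h13, h23⟩ := Finset.two_lt_card.1 hc
  simp only [Finset.mem_filter, Finset.mem_univ, true_and] at h1 h2 h3
  exact ⟨c, t₁, t₁.2, t₂, t₂.2, t₃, t₃.2, fun e => h12 (Subtype.ext e),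
    fun e => h13 (Subtype.ext e), fun e => h23 (Subtype.ext e), ⟨_, h1⟩, ⟨_, h2⟩, ⟨_, h3⟩⟩

theorem mem_of_longest [Finite V] (htough : Tough 23 G) (hfree : P4P1Free G) (hL : IsCyc G L)
    (hlen : 2 ≤ L.length) (hmax : ∀ L', IsCyc G L' → L'.length ≤ L.length) (h : V) : h ∈ L := by
  classical
  by_contra hhL
  let c₀ := (G.induce {v | v ∈ L}ᶜ).connectedComponentMk ⟨h, hhL⟩
  have hh : h ∈ compSet _ c₀ := ⟨hhL, rfl⟩
  obtain ⟨T, hWT, ⟨hTL, hlink⟩, hTmax⟩ := Finite.exists_le_maximal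
    (p := fun T : Set V => (∀ t ∈ T, t ∈ L) ∧ Linkable G L (compSet _ c₀) T)
    ⟨fun t ht => ht.1, linkable_of_longest hL hmax c₀⟩
  have hLH : ∀ v ∈ L, v ∉ compSet _ c₀ := fun v hv hvH => hvH.1 hv
  have hclosed : ∀ u ∈ compSet _ c₀, ∀ w, w ∉ T → G.Adj u w → w ∈ compSet _ c₀ := by
    intro u hu w hw huw
    by_contra hwH
    have hwL := mem_of_adj_compSet hu huw hwH
    exact hw (hWT ⟨hwL, u, hu, huw⟩)
  have hTmax' : ∀ y ∈ L, y ∉ T → ¬ Linkable G L (compSet _ c₀) (insert y T) := by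
    intro y hy hyT hlink'
    have h1 : ∀ t ∈ insert y T, t ∈ L := by
      rintro t (rfl | ht)
      · exact hy
      · exact hTL t ht
    exact hyT (hTmax ⟨h1, hlink'⟩ (Set.subset_insert y T) (Set.mem_insert y T))
  have hsucc : ∀ t, ∃ a, t ∈ T → CycSucc L t a ∧ a ∉ T := by
    intro t
    by_cases ht : t ∈ T
    · obtain ⟨a, ha⟩ := exists_cycSucc (hTL t ht)
      refine ⟨a, fun _ => ⟨ha, hlink.not_mem_of_cycSucc hL hLH ha ?_ ht⟩⟩
      rintro rfl
      obtain ⟨R, hR, h1, h2⟩ := ha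
      have hnd := hR.nodup_iff.1 hL.2.1
      have hRlen : 2 ≤ R.length := hR.perm.length_eq ▸ hlen
      match R, h1, h2, hnd, hRlen with
      | x :: y :: R, h1, h2, hnd, _ =>
        rw [List.getLast?_cons_cons] at h2
        rw [List.head?_cons, Option.some.injEq] at h1
        exact (List.nodup_cons.1 hnd).1 (h1 ▸ List.mem_of_getLast? h2)
    · exact ⟨t, fun h => absurd h ht⟩
  choose f hf using hsucc
  have hmemL : ∀ {t a}, CycSucc L t a → a ∈ L := fun ⟨R, hR, h1, _⟩ =>
    hR.mem_iff.2 (List.mem_of_head? h1)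
  have hdisj : ∀ c : (G.induce Tᶜ).ConnectedComponent, ∀ v ∈ compSet T c, v ∈ L →
      ∀ u ∈ compSet T c, u ∉ compSet _ c₀ := by
    intro c v hv hvL u hu huH
    exact hLH v hvL (compSet_subset hu huH hclosed hv)
  have hhT : h ∉ T := fun hT => hhL (hTL h hT)
  have hcomps : 2 ≤ ncomps G T := by
    obtain ⟨v, hvL, hvT⟩ : ∃ v ∈ L, v ∉ T := by
      obtain ⟨v, hv⟩ := List.exists_mem_of_ne_nil L hL.1
      by_cases hvT : v ∈ T
      · exact ⟨f v, hmemL (hf v hvT).1, (hf v hvT).2⟩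
      · exact ⟨v, hv, hvT⟩
    have : Nontrivial (G.induce Tᶜ).ConnectedComponent := by
      refine ⟨(G.induce Tᶜ).connectedComponentMk ⟨v, hvT⟩,
        (G.induce Tᶜ).connectedComponentMk ⟨h, hhT⟩, fun e => ?_⟩
      exact hdisj _ v ⟨hvT, e⟩ hvL h ⟨hhT, rfl⟩ hh
    exact Finite.one_lt_card
  obtain ⟨c, t₁, ht₁, t₂, ht₂, t₃, ht₃, h12, h13, h23, hc1, hc2, hc3⟩ :=
    exists_three_of_tough htough hcomps f fun t ht => (hf t ht).2
  have hDH := hdisj c _ hc1 (hmemL (hf _ ht₁).1)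
  have hDT : ∀ v ∈ compSet T c, v ∉ T := fun v hv => hv.1
  have hP4 : NoP4 G (compSet T c) := by
    refine hfree.noP4 (e := h) (fun hc => hDH h hc hh) fun v hv hhv => ?_
    exact hDH v hv (hclosed h hh v (hDT v hv) hhv)
  have hfin : (compSet T c).Finite := Set.toFinite _
  have hcard : 2 ≤ hfin.toFinset.card := by
    refine Finset.one_lt_card.2 ⟨f t₁, by simpa, f t₂, by simpa, fun e => h12 ?_⟩
    exact (hf _ ht₁).1.unique_left hL.2.1 (e ▸ (hf _ ht₂).1)
  have hsplit := NoP4.splits_or_splits_compl (G := G) hfin.toFinset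
  rw [hfin.coe_toFinset] at hsplit
  obtain ⟨X, Y, hXY, hX, hY, hXYd, hno⟩ :=
    (hsplit hP4 hcard).resolve_left (not_splits_compSet c)
  refine hlink.false_of_join hL hLH hTL hTmax'
    (fun v hv w hvw hw => mem_of_adj_compSet hv hvw hw) hDT hDH hXY hX hY hXYd ?_ ?_
  · intro x hx y hy
    have hne : x ≠ y := fun e => Set.disjoint_left.1 hXYd hx (e ▸ hy)
    simpa [hne] using hno x hx y hy
  · have key : ∀ t ∈ T, f t ∈ compSet T c → ∃ a ∈ compSet T c, CycSucc L t a :=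
      fun t ht hft => ⟨f t, hft, (hf t ht).1⟩
    intro x
    by_cases hx1 : t₁ = x
    · exact ⟨t₂, ht₂, t₃, ht₃, h23, fun e => h12 (hx1.trans e.symm), fun e => h13 (hx1.trans e.symm),
        key _ ht₂ hc2, key _ ht₃ hc3⟩
    by_cases hx2 : t₂ = x
    · exact ⟨t₁, ht₁, t₃, ht₃, h13, hx1, fun e => h23 (hx2.trans e.symm),
        key _ ht₁ hc1, key _ ht₃ hc3⟩
    · exact ⟨t₁, ht₁, t₂, ht₂, h12, hx1, hx2, key _ ht₁ hc1, key _ ht₂ hc2⟩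

theorem exists_adj_of_tough [Finite V] [Nontrivial V] (htough : Tough 23 G) :
    ∃ x y, G.Adj x y := by
  by_contra! hno
  obtain ⟨x, y, hxy⟩ := exists_pair_ne V
  have h2 : 2 ≤ ncomps G ∅ := by
    have : Nontrivial (G.induce (∅ : Set V)ᶜ).ConnectedComponent := by
      refine ⟨(G.induce ∅ᶜ).connectedComponentMk ⟨x, by simp⟩,
        (G.induce ∅ᶜ).connectedComponentMk ⟨y, by simp⟩, fun e => ?_⟩
      rw [SimpleGraph.ConnectedComponent.eq] at e
      obtain ⟨p⟩ := e
      cases p with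
      | nil => exact hxy rfl
      | cons h p => exact hno _ _ (by simpa using h)
    exact Finite.one_lt_card
  have h := htough ∅ h2
  rw [Set.ncard_empty] at h
  have h3 : 23 * ncomps G ∅ ≤ 0 := by exact_mod_cast h
  omega

theorem exists_longest [Finite V] (h : IsCyc G L) :
    ∃ L₁, IsCyc G L₁ ∧ L.length ≤ L₁.length ∧ ∀ L', IsCyc G L' → L'.length ≤ L₁.length := by
  have := Fintype.ofFinite V
  have hb : ∀ n ∈ {n | ∃ L', IsCyc G L' ∧ L'.length = n}, n ≤ Fintype.card V := by
    rintro n ⟨L', hL', rfl⟩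
    exact hL'.2.1.length_le_card
  have hfin : {n | ∃ L', IsCyc G L' ∧ L'.length = n}.Finite :=
    (Set.finite_Iic (Fintype.card V)).subset hb
  obtain ⟨n, hn, ⟨L₁, hL₁, rfl⟩, hmax⟩ := hfin.exists_le_maximal ⟨L, h, rfl⟩
  refine ⟨L₁, hL₁, hn, fun L' hL' => ?_⟩
  by_contra! hlt
  exact absurd (hmax ⟨L', hL', rfl⟩ hlt.le) (by omega)

theorem IsCyc.exists_isHamiltonianCycle [Fintype V] [DecidableEq V] (hL : IsCyc G L)
    (hn : 3 ≤ Fintype.card V) (hspan : ∀ v, v ∈ L) :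
    ∃ a, ∃ p : G.Walk a a, p.IsHamiltonianCycle := by
  obtain ⟨h0, hnd, hch⟩ := hL
  obtain ⟨a, L, rfl⟩ := List.exists_cons_of_ne_nil h0
  have hlen : (a :: L).length = Fintype.card V := by
    rw [← List.toFinset_card_of_nodup hnd, ← Finset.card_univ]
    congr 1
    ext v
    simpa using hspan v
  have hc : (a :: (L ++ [a])).IsChain G.Adj := by
    have e : (a :: L) ++ (a :: L) = (a :: (L ++ [a])) ++ L := by simp
    rw [e] at hch
    exact hch.left_of_append
  obtain ⟨p, hsupp⟩ : ∃ p : G.Walk a a, p.support = a :: (L ++ [a]) := by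
    refine ⟨(Walk.ofSupport _ (List.cons_ne_nil a (L ++ [a])) hc).copy (u' := a) List.head_cons
      (by simp), ?_⟩
    rw [Walk.support_copy, Walk.support_ofSupport]
  have hplen : p.length = Fintype.card V := by
    have := p.length_support
    rw [hsupp] at this
    simp at this hlen
    omega
  refine ⟨a, p, Walk.isHamiltonianCycle_iff_isCycle_and_length_eq.2 ⟨?_, hplen⟩⟩
  refine Walk.isCycle_iff_isPath_tail_and_le_length.2 ⟨?_, by omega⟩
  have hnil : ¬ p.Nil := by
    rw [← Walk.length_eq_zero_iff]
    omega
  rw [Walk.isPath_def, Walk.support_tail_of_not_nil _ hnil, hsupp]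
  exact List.nodup_append_comm.1 (by simpa using hnd)

end Longest

/-- Every 23-tough `(P₄ ∪ P₁)`-free graph on at least three vertices is Hamiltonian. -/
theorem stmt0 {V : Type*} [Fintype V] [DecidableEq V] (G : SimpleGraph V)
    (htough : Tough 23 G) (hfree : P4P1Free G) (hn : 3 ≤ Fintype.card V) :
    ∃ a, ∃ p : G.Walk a a, p.IsHamiltonianCycle := by
  have : Nontrivial V := Fintype.one_lt_card_iff_nontrivial.1 (by omega)
  obtain ⟨x, y, hxy⟩ := exists_adj_of_tough htough
  have hcyc : IsCyc G [x, y] :=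
    ⟨by simp, by simpa using hxy.ne, by simp [hxy, hxy.symm]⟩
  obtain ⟨L, hL, hlen, hmax⟩ := exists_longest hcyc
  exact hL.exists_isHamiltonianCycle hn (mem_of_longest htough hfree hL hlen hmax)
end

section
/- Let $G$ be a $P_4$-free graph with scattering number $s(G) = 0$ such that $G$ is not a balanced complete bipartite graph, and let $S \subseteq V(G)$ be a maximal scattering set of $G$. Then for any two distinct vertices $u, v \in V(G)$ with at most one of $u, v$ belonging to $S$, the graph $G$ has a Hamiltonian path with endvertices $u$ and $v$. -/
open SimpleGraph

section Breaks

variable {V : Type*} (G : SimpleGraph V)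

open Classical in
/-- The number of consecutive nonadjacent pairs in a list of vertices. A duplicate-free list with
`k` breaks encodes a cover of its vertices by `k + 1` disjoint paths. -/
noncomputable def breaks : List V → ℕ
  | [] => 0
  | [_] => 0
  | a :: b :: l => (if G.Adj a b then 0 else 1) + breaks (b :: l)

variable {G}

lemma breaks_cons_cons_of_adj {a b : V} {l : List V} (h : G.Adj a b) :
    breaks G (a :: b :: l) = breaks G (b :: l) := by simp [breaks, h]

lemma breaks_cons_cons_le (a b : V) (l : List V) :
    breaks G (a :: b :: l) ≤ breaks G (b :: l) + 1 := by
  rw [breaks]; split_ifs <;> omega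

lemma breaks_le_length (a : V) (l : List V) : breaks G (a :: l) ≤ l.length := by
  induction l generalizing a with
  | nil => simp [breaks]
  | cons b l ih =>
    have := breaks_cons_cons_le (G := G) a b l
    have := ih b
    simp only [List.length_cons]
    omega

lemma breaks_append_le (l m : List V) : breaks G (l ++ m) ≤ breaks G l + breaks G m + 1 := by
  induction l with
  | nil => simp [breaks]
  | cons a l ih =>
    cases l with
    | nil =>
      cases m with
      | nil => simp [breaks]
      | cons b m => have := breaks_cons_cons_le (G := G) a b m; simp [breaks] at *; omega
    | cons b l => simp only [List.cons_append, breaks] at *; omega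

lemma le_breaks_append (l m : List V) : breaks G l + breaks G m ≤ breaks G (l ++ m) := by
  induction l with
  | nil => simp [breaks]
  | cons a l ih =>
    cases l with
    | nil => cases m <;> simp [breaks]
    | cons b l => simp only [List.cons_append, breaks] at *; omega

lemma breaks_cons_of_forall_adj {a : V} {l : List V} (h : ∀ b ∈ l, G.Adj a b) :
    breaks G (a :: l) = breaks G l := by
  cases l with
  | nil => simp [breaks]
  | cons b l => exact breaks_cons_cons_of_adj (h b (by simp))

lemma breaks_concat_of_adj_getLast {a b : V} {l : List V} (hb : b ∈ l.getLast?)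
    (h : G.Adj b a) : breaks G (l ++ [a]) = breaks G l := by
  induction l with
  | nil => simp at hb
  | cons c l ih =>
    cases l with
    | nil => simp at hb; subst hb; simp [breaks, h]
    | cons d l =>
      have := ih (by simpa using hb)
      simp only [List.cons_append, breaks] at *
      rw [this]

lemma breaks_reverse_le (l : List V) : breaks G l.reverse ≤ breaks G l := by
  induction l with
  | nil => simp
  | cons a l ih =>
    cases l with
    | nil => simp
    | cons b l =>
      rw [List.reverse_cons, breaks]
      split_ifs with h
      · rw [breaks_concat_of_adj_getLast (b := b) (by simp) h.symm]
        omega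
      · have := breaks_append_le (G := G) (b :: l).reverse [a]
        simp only [breaks] at this
        omega

lemma isChain_of_breaks_eq_zero {l : List V} (h : breaks G l = 0) : l.IsChain G.Adj := by
  induction l with
  | nil => simp
  | cons a l ih =>
    cases l with
    | nil => simp
    | cons b l =>
      rw [breaks] at h
      by_cases hab : G.Adj a b
      · exact List.isChain_cons_cons.2 ⟨hab, ih (by omega)⟩
      · simp [hab] at h

/-- Vertices adjacent to all members of a list can be inserted into its gaps, each one
removing a break. -/
lemma exists_insert_breaks (l : List V) (a : V) (xs : List V)
    (hadj : ∀ x ∈ xs, ∀ y ∈ a :: l, G.Adj x y) (hlen : xs.length ≤ l.length) :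
    ∃ m, m.Perm (l ++ xs) ∧ (a :: m).getLast? = (a :: l).getLast? ∧
      breaks G (a :: m) ≤ breaks G (a :: l) - xs.length := by
  induction l generalizing a xs with
  | nil =>
    obtain rfl : xs = [] := by simpa using hlen
    exact ⟨[], by simp, rfl, by simp [breaks]⟩
  | cons b l ih =>
    cases xs with
    | nil => exact ⟨b :: l, by simp, rfl, by simp⟩
    | cons x xs =>
      simp only [List.length_cons] at hlen
      by_cases h : G.Adj a b ∧ xs.length + 1 ≤ l.length
      · obtain ⟨m, hp, hl, hb⟩ := ih b (x :: xs)
          (fun y hy z hz => hadj y hy z (List.mem_cons_of_mem _ hz)) (by simpa using h.2)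
        refine ⟨b :: m, by simpa using hp, by simpa using hl, ?_⟩
        rw [breaks_cons_cons_of_adj h.1, breaks_cons_cons_of_adj h.1]
        exact hb
      · obtain ⟨m, hp, hl, hb⟩ := ih b xs
          (fun y hy z hz => hadj y (List.mem_cons_of_mem _ hy) z (List.mem_cons_of_mem _ hz))
          (by omega)
        refine ⟨x :: b :: m, ?_, by simpa using hl, ?_⟩
        · have : (x :: b :: m).Perm (x :: b :: (l ++ xs)) := (hp.cons b).cons x
          refine this.trans ?_
          simpa using (List.perm_middle (a := x) (l₁ := b :: l) (l₂ := xs)).symm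
        · rw [breaks_cons_cons_of_adj (hadj x (by simp) a (by simp)).symm,
            breaks_cons_cons_of_adj (hadj x (by simp) b (by simp))]
          have h2 := breaks_le_length (G := G) b l
          rw [breaks, List.length_cons]
          split_ifs with hab <;> [skip; omega]
          have : l.length < xs.length + 1 := by
            by_contra hc; exact h ⟨hab, by omega⟩
          omega

/-- A variant of `exists_insert_breaks` where one of the vertices may go to the end of the list. -/
lemma exists_insert_breaks_of_length_le (l : List V) (a : V) (xs : List V)
    (hadj : ∀ x ∈ xs, ∀ y ∈ a :: l, G.Adj x y) (hlen : xs.length ≤ l.length + 1) :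
    ∃ m, m.Perm (l ++ xs) ∧ breaks G (a :: m) ≤ breaks G (a :: l) - xs.length := by
  by_cases h : xs.length ≤ l.length
  · obtain ⟨m, h1, -, h2⟩ := exists_insert_breaks l a xs hadj h
    exact ⟨m, h1, h2⟩
  · cases xs with
    | nil => simp at h
    | cons x xs =>
      simp only [List.length_cons] at h hlen ⊢
      obtain ⟨m, h1, h2, h3⟩ := exists_insert_breaks l a xs
        (fun y hy z hz => hadj y (List.mem_cons_of_mem _ hy) z hz) (by omega)
      refine ⟨m ++ [x], ?_, ?_⟩
      · have : (m ++ [x]).Perm (x :: (l ++ xs)) := (List.perm_append_comm).trans (h1.cons x)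
        exact this.trans List.perm_middle.symm
      · have hlast : (a :: l).getLast (by simp) ∈ (a :: m).getLast? := by
          rw [h2]; exact List.getLast_mem_getLast? _
        have := breaks_concat_of_adj_getLast hlast
          (hadj x (by simp) _ (List.getLast_mem (by simp))).symm
        rw [List.cons_append] at this
        rw [this]
        have h4 := breaks_le_length (G := G) a l
        omega

end Breaks

section Split

variable {V : Type*}

/-- A relation with no induced path `a - b - c - d`. -/
def NoInducedP4 (r : V → V → Prop) : Prop :=
  ∀ ⦃a b c d⦄, a ≠ c → a ≠ d → b ≠ d → r a b → r b c → r c d → ¬ r a c → ¬ r a d → ¬ r b d → False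

lemma P4Free.noInducedP4 {G : SimpleGraph V} (h : P4Free G) : NoInducedP4 G.Adj := by
  intro a b c d hac had hbd ab bc cd nac nad nbd
  refine h.false ⟨⟨![a, b, c, d], ?_⟩, ?_⟩
  · intro i j hij
    have := ab.ne; have := bc.ne; have := cd.ne
    fin_cases i <;> fin_cases j <;> simp_all
  · have nca : ¬ G.Adj c a := fun h => nac h.symm
    have nda : ¬ G.Adj d a := fun h => nad h.symm
    have ndb : ¬ G.Adj d b := fun h => nbd h.symm
    intro i j
    change G.Adj (![a, b, c, d] i) (![a, b, c, d] j) ↔ _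
    fin_cases i <;> fin_cases j <;>
      simp [SimpleGraph.pathGraph_adj, ab, bc, cd, ab.symm, bc.symm, cd.symm, nac, nad, nbd,
        nca, nda, ndb]

lemma NoInducedP4.compl {G : SimpleGraph V} (h : NoInducedP4 G.Adj) : NoInducedP4 Gᶜ.Adj := by
  intro a b c d hac had hbd ab bc cd nac nad nbd
  simp only [compl_adj, not_and, not_not] at *
  exact h ab.1.symm bc.1 cd.1.symm (nbd hbd) (nad had).symm (nac hac)
    (fun h => ab.2 h.symm) bc.2 (fun h => cd.2 h.symm)

variable [DecidableEq V]

/-- `W` splits into two nonempty parts that are completely joined by `r`. -/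
def HasSplit (r : V → V → Prop) (W : Finset V) : Prop :=
  ∃ X Y : Finset V, X.Nonempty ∧ Y.Nonempty ∧ Disjoint X Y ∧ X ∪ Y = W ∧ ∀ x ∈ X, ∀ y ∈ Y, r x y

lemma HasSplit.insert_of_compl {G : SimpleGraph V} (h : NoInducedP4 G.Adj) {W : Finset V} {w : V}
    (hw : w ∉ W) (hs : HasSplit Gᶜ.Adj W) :
    HasSplit G.Adj (insert w W) ∨ HasSplit Gᶜ.Adj (insert w W) := by
  classical
  by_cases hall : ∀ y ∈ W, G.Adj w y
  · obtain ⟨X, Y, hX, -, -, rfl, -⟩ := hs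
    refine Or.inl ⟨{w}, X ∪ Y, by simp, hX.mono Finset.subset_union_left, by simpa using hw,
      rfl, by simpa using hall⟩
  right
  by_cases hN : ∃ x ∈ W, ∃ y ∈ W, G.Adj w x ∧ ¬ G.Adj w y ∧ G.Adj x y
  · obtain ⟨x, hx, y, hy, hwx, hwy, hxy⟩ := hN
    wlog hxX : ∃ X Y : Finset V, X.Nonempty ∧ Y.Nonempty ∧ Disjoint X Y ∧ X ∪ Y = W ∧
        (∀ x ∈ X, ∀ y ∈ Y, Gᶜ.Adj x y) ∧ x ∈ X generalizing
    · obtain ⟨X, Y, hX, hY, hd, rfl, hadj⟩ := hs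
      refine absurd ?_ hxX
      rcases Finset.mem_union.1 hx with hx | hx
      · exact ⟨X, Y, hX, hY, hd, rfl, hadj, hx⟩
      · exact ⟨Y, X, hY, hX, hd.symm, Finset.union_comm _ _,
          fun a ha b hb => (hadj b hb a ha).symm, hx⟩
    obtain ⟨X, Y, hX, hY, hd, rfl, hadj, hxX⟩ := hxX
    have hyX : y ∈ X := by
      rcases Finset.mem_union.1 hy with hy | hy
      · exact hy
      · exact absurd hxy (hadj x hxX y hy).2
    refine ⟨insert w X, Y, by simp, hY, ?_, by simp [Finset.insert_union], ?_⟩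
    · simp only [Finset.mem_union, not_or] at hw
      simp [hd, hw.2]
    · intro a ha z hz
      rcases Finset.mem_insert.1 ha with rfl | ha
      · refine ⟨fun e => hw (by simp [e, hz]), fun haz => ?_⟩
        exact h (hadj x hxX z hz).1.symm (hadj y hyX z hz).1.symm (fun e => hw (by rw [e]; exact hy))
          haz.symm hwx hxy (fun h => (hadj x hxX z hz).2 h.symm)
          (fun h => (hadj y hyX z hz).2 h.symm) hwy
      · exact hadj a ha z hz
  · push Not at hN hall
    obtain ⟨y, hy, hwy⟩ := hall
    refine ⟨W.filter fun z => ¬ G.Adj w z, insert w (W.filter fun z => G.Adj w z),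
      ⟨y, by simp [hy, hwy]⟩, by simp, ?_, ?_, ?_⟩
    · rw [Finset.disjoint_left]
      intro z hz hz'
      simp only [Finset.mem_filter, Finset.mem_insert] at hz hz'
      rcases hz' with rfl | hz'
      · exact hw hz.1
      · exact hz.2 hz'.2
    · ext z
      simp only [Finset.mem_filter, Finset.mem_insert, Finset.mem_union]
      tauto
    · intro a ha z hz
      simp only [Finset.mem_filter, Finset.mem_insert] at ha hz
      rcases hz with rfl | hz
      · exact ⟨fun e => hw (e ▸ ha.1), fun e => ha.2 e.symm⟩
      · exact ⟨fun e => ha.2 (e ▸ hz.2), fun e => hN z hz.1 a ha.1 hz.2 ha.2 e.symm⟩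

/-- Seinsche's theorem: in a `P₄`-free graph every set of at least two vertices induces a
disconnected graph or a graph with disconnected complement. -/
lemma NoInducedP4.hasSplit {G : SimpleGraph V} (h : NoInducedP4 G.Adj) {W : Finset V}
    (hW : W.Nontrivial) : HasSplit G.Adj W ∨ HasSplit Gᶜ.Adj W := by
  induction W using Finset.induction_on with
  | empty => simp at hW
  | insert w W hw ih =>
    by_cases hW' : W.Nontrivial
    · rcases ih hW' with hs | hs
      · have := HasSplit.insert_of_compl (G := Gᶜ) h.compl hw (by simpa using hs)
        rw [compl_compl] at this
        exact this.symm
      · exact hs.insert_of_compl h hw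
    · have hne : W.Nonempty := by
        rw [Finset.nonempty_iff_ne_empty]
        rintro rfl
        simp at hW
      obtain ⟨y, rfl⟩ : ∃ y, W = {y} := by
        rcases hne.exists_eq_singleton_or_nontrivial with h | h
        · exact h
        · exact absurd h hW'
      have hwy : w ≠ y := by simpa using hw
      by_cases hadj : G.Adj w y
      · exact Or.inl ⟨{w}, {y}, by simp, by simp, by simpa using hwy, rfl, by simpa using hadj⟩
      · exact Or.inr ⟨{w}, {y}, by simp, by simp, by simpa using hwy, rfl,
          by simpa using ⟨hwy, hadj⟩⟩

end Split

section NumComponents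

variable {V : Type*} (G : SimpleGraph V)

/-- The number of connected components of the subgraph induced by `W`. -/
noncomputable def numComponents (W : Finset V) : ℕ :=
  Nat.card (G.induce (W : Set V)).ConnectedComponent

variable {G}

lemma numComponents_pos {W : Finset V} (h : W.Nonempty) : 1 ≤ numComponents G W := by
  obtain ⟨w, hw⟩ := h
  have : Nonempty (G.induce (W : Set V)).ConnectedComponent :=
    ⟨(G.induce (W : Set V)).connectedComponentMk ⟨w, hw⟩⟩
  exact Nat.card_pos

lemma numComponents_le_card (W : Finset V) : numComponents G W ≤ W.card := by
  have := Nat.card_le_card_of_surjective (G.induce (W : Set V)).connectedComponentMk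
    (fun c => c.exists_rep)
  simpa [numComponents] using this

lemma numComponents_empty : numComponents G ∅ = 0 := by
  simpa using numComponents_le_card (G := G) ∅

lemma not_adj_of_numComponents_eq_card {W : Finset V} (h : numComponents G W = W.card)
    {x y : V} (hx : x ∈ W) (hy : y ∈ W) : ¬ G.Adj x y := by
  intro hadj
  have hbij : Function.Bijective (G.induce (W : Set V)).connectedComponentMk := by
    refine (Nat.bijective_iff_surjective_and_card _).2 ⟨fun c => c.exists_rep, ?_⟩
    have hcard : Nat.card (W : Set V) = W.card := by simp
    exact hcard.trans h.symm
  have h1 : (G.induce (W : Set V)).Adj ⟨x, hx⟩ ⟨y, hy⟩ := hadj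
  have h2 := hbij.1 (SimpleGraph.ConnectedComponent.sound h1.reachable)
  exact hadj.ne (congrArg Subtype.val h2)

lemma numComponents_eq_one_of_adj [DecidableEq V] {X Y : Finset V} (hX : X.Nonempty)
    (hY : Y.Nonempty) (hadj : ∀ x ∈ X, ∀ y ∈ Y, G.Adj x y) : numComponents G (X ∪ Y) = 1 := by
  obtain ⟨x₀, hx₀⟩ := hX
  obtain ⟨y₀, hy₀⟩ := hY
  refine le_antisymm ?_ (numComponents_pos ⟨x₀, by simp [hx₀]⟩)
  have hmem {z : V} : z ∈ ((X ∪ Y : Finset V) : Set V) ↔ z ∈ X ∨ z ∈ Y := by simp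
  have hXr (x) (hx : x ∈ X) (y) (hy : y ∈ Y) :
      (G.induce ((X ∪ Y : Finset V) : Set V)).Reachable ⟨x, hmem.2 (.inl hx)⟩
        ⟨y, hmem.2 (.inr hy)⟩ :=
    Adj.reachable (by simpa using hadj x hx y hy)
  have hr (z : ((X ∪ Y : Finset V) : Set V)) :
      (G.induce ((X ∪ Y : Finset V) : Set V)).Reachable z ⟨x₀, hmem.2 (.inl hx₀)⟩ := by
    obtain ⟨z, hz⟩ := z
    rcases hmem.1 hz with hz | hz
    · exact (hXr z hz y₀ hy₀).trans (hXr x₀ hx₀ y₀ hy₀).symm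
    · exact (hXr x₀ hx₀ z hz).symm
  have : Subsingleton (G.induce ((X ∪ Y : Finset V) : Set V)).ConnectedComponent :=
    SimpleGraph.Preconnected.subsingleton_connectedComponent
      fun a b => (hr a).trans (hr b).symm
  exact Finite.card_le_one_iff_subsingleton.2 this

lemma reachable_induce_of_closed {X W : Set V}
    (hX : ∀ x ∈ X, ∀ y ∈ W, G.Adj x y → y ∈ X) {a b : W} (h : (G.induce W).Reachable a b)
    (ha : (a : V) ∈ X) : ∃ hb : (b : V) ∈ X, (G.induce X).Reachable ⟨a, ha⟩ ⟨b, hb⟩ := by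
  obtain ⟨p⟩ := h
  induction p with
  | nil => exact ⟨ha, .rfl⟩
  | @cons u v w huv p ih =>
    have hv : (v : V) ∈ X := hX u ha v v.2 huv
    obtain ⟨hb, hr⟩ := ih hv
    refine ⟨hb, Reachable.trans (Adj.reachable ?_) hr⟩
    exact huv

lemma numComponents_union [DecidableEq V] {X Y : Finset V} (hd : Disjoint X Y)
    (hadj : ∀ x ∈ X, ∀ y ∈ Y, ¬ G.Adj x y) :
    numComponents G (X ∪ Y) = numComponents G X + numComponents G Y := by
  have hXW : (X : Set V) ⊆ ((X ∪ Y : Finset V) : Set V) := by simp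
  have hYW : (Y : Set V) ⊆ ((X ∪ Y : Finset V) : Set V) := by simp
  have hXc : ∀ x ∈ (X : Set V),
      ∀ y ∈ ((X ∪ Y : Finset V) : Set V), G.Adj x y → y ∈ (X : Set V) := by
    intro x hx y hy hxy
    by_contra hyX
    exact hadj x hx y (by simpa [show y ∉ X from hyX] using hy) hxy
  have hYc : ∀ x ∈ (Y : Set V),
      ∀ y ∈ ((X ∪ Y : Finset V) : Set V), G.Adj x y → y ∈ (Y : Set V) := by
    intro x hx y hy hxy
    by_contra hyY
    exact hadj y (by simpa [show y ∉ Y from hyY] using hy) x hx hxy.symm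
  let f : (G.induce (X : Set V)).ConnectedComponent ⊕ (G.induce (Y : Set V)).ConnectedComponent →
      (G.induce ((X ∪ Y : Finset V) : Set V)).ConnectedComponent :=
    Sum.elim (ConnectedComponent.map (induceHomOfLE G hXW).toHom)
      (ConnectedComponent.map (induceHomOfLE G hYW).toHom)
  have hf : Function.Bijective f := by
    constructor
    · rintro (a | a) (b | b) hab <;> induction a using ConnectedComponent.ind <;>
        induction b using ConnectedComponent.ind <;> rename_i a b <;>
        have hr := ConnectedComponent.exact hab
      · obtain ⟨_, hr⟩ := reachable_induce_of_closed hXc hr a.2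
        exact congrArg Sum.inl (ConnectedComponent.sound hr)
      · obtain ⟨hb, -⟩ := reachable_induce_of_closed hXc hr a.2
        exact absurd b.2 (Finset.disjoint_left.1 hd hb)
      · obtain ⟨hb, -⟩ := reachable_induce_of_closed hYc hr a.2
        exact absurd hb (Finset.disjoint_left.1 hd b.2)
      · obtain ⟨_, hr⟩ := reachable_induce_of_closed hYc hr a.2
        exact congrArg Sum.inr (ConnectedComponent.sound hr)
    · intro c
      induction c using ConnectedComponent.ind with
      | h z =>
        obtain ⟨z, hz⟩ := z
        have hz' : z ∈ X ∨ z ∈ Y := by simpa using hz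
        rcases hz' with h | h
        · exact ⟨.inl ((G.induce (X : Set V)).connectedComponentMk ⟨z, h⟩), rfl⟩
        · exact ⟨.inr ((G.induce (Y : Set V)).connectedComponentMk ⟨z, h⟩), rfl⟩
  rw [numComponents, ← Nat.card_eq_of_bijective f hf, Nat.card_sum]
  rfl

end NumComponents

section Cover

variable {V : Type*} [DecidableEq V] (G : SimpleGraph V)

/-- The number of components left over after deleting `T` from `W`, minus the size of `T`. -/
noncomputable def excess (W T : Finset V) : ℤ := numComponents G (W \ T) - T.card

/-- `T` maximizes the excess in `W`, and no proper superset of `T` does. -/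
def IsMaxExcess (W T : Finset V) : Prop :=
  T ⊆ W ∧ ∀ T' ⊆ W, excess G W T' ≤ excess G W T ∧ (T ⊂ T' → excess G W T' < excess G W T)

/-- For each inclusion-maximal set `T` of maximum excess in `W` and each `v ∈ W \ T`, the set `W`
has a path cover by at most `excess G W T` paths, one of which starts at `v`. -/
def HasCover (W : Finset V) : Prop :=
  ∀ T, IsMaxExcess G W T → ∀ v ∈ W, v ∉ T →
    ∃ m, (v :: m).Perm W.toList ∧ (breaks G (v :: m) : ℤ) + 1 ≤ excess G W T

variable {G}

lemma exists_isMaxExcess (W : Finset V) : ∃ T, IsMaxExcess G W T := by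
  obtain ⟨T₀, hT₀, h₀⟩ := W.powerset.exists_max_image (excess G W) ⟨∅, by simp⟩
  obtain ⟨T, hT, h⟩ := (W.powerset.filter fun T => excess G W T = excess G W T₀).exists_max_image
    Finset.card ⟨T₀, by simpa using hT₀⟩
  simp only [Finset.mem_filter, Finset.mem_powerset] at *
  refine ⟨T, hT.1, fun T' hT' => ⟨hT.2 ▸ h₀ T' hT', fun hlt => ?_⟩⟩
  refine lt_of_le_of_ne (hT.2 ▸ h₀ T' hT') fun heq => ?_
  exact absurd (h T' ⟨hT', heq.trans hT.2⟩) (not_le.2 (Finset.card_lt_card hlt))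

lemma excess_le_card (W T : Finset V) : excess G W T ≤ W.card := by
  have h1 := numComponents_le_card (G := G) (W \ T)
  have h2 := Finset.card_le_card (Finset.sdiff_subset (s := W) (t := T))
  rw [excess]; omega

lemma IsMaxExcess.one_le {W T : Finset V} (h : IsMaxExcess G W T) (hW : W.Nonempty) :
    1 ≤ excess G W T := by
  have h1 := (h.2 ∅ (by simp)).1
  have h2 := numComponents_pos (G := G) hW
  simp only [excess, Finset.sdiff_empty, Finset.card_empty] at *
  omega

lemma IsMaxExcess.exists_notMem {W T : Finset V} (h : IsMaxExcess G W T) (hW : W.Nonempty) :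
    ∃ v ∈ W, v ∉ T := by
  by_contra! hc
  have h1 := h.one_le hW
  rw [excess, Finset.sdiff_eq_empty_iff_subset.2 hc, numComponents_empty] at h1
  omega

lemma HasCover.exists_list {W T : Finset V} (hc : HasCover G W) (h : IsMaxExcess G W T)
    (hW : W.Nonempty) : ∃ l, l.Perm W.toList ∧ (breaks G l : ℤ) + 1 ≤ excess G W T := by
  obtain ⟨v, hv, hvT⟩ := h.exists_notMem hW
  obtain ⟨m, hm⟩ := hc T h v hv hvT
  exact ⟨_, hm⟩

lemma excess_union {X Y : Finset V} (hd : Disjoint X Y) (hadj : ∀ x ∈ X, ∀ y ∈ Y, ¬ G.Adj x y)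
    {S T : Finset V} (hS : S ⊆ X) (hT : T ⊆ Y) :
    excess G (X ∪ Y) (S ∪ T) = excess G X S + excess G Y T := by
  have h1 : (X ∪ Y) \ (S ∪ T) = X \ S ∪ Y \ T := by
    ext z
    have h0 : z ∈ X → z ∉ Y := fun h => Finset.disjoint_left.1 hd h
    have := @hS z
    have := @hT z
    simp only [Finset.mem_sdiff, Finset.mem_union]
    tauto
  rw [excess, h1, numComponents_union (hd.mono Finset.sdiff_subset Finset.sdiff_subset)
    (fun x hx y hy => hadj x (Finset.sdiff_subset hx) y (Finset.sdiff_subset hy)),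
    Finset.card_union_of_disjoint (hd.mono hS hT), excess, excess]
  push_cast
  ring

lemma excess_union_left {X Y : Finset V} (hd : Disjoint X Y) {T : Finset V} (hT : T ⊆ Y) :
    excess G (X ∪ Y) (X ∪ T) = excess G Y T - X.card := by
  have h1 : (X ∪ Y) \ (X ∪ T) = Y \ T := by
    ext z
    have h0 : z ∈ X → z ∉ Y := fun h => Finset.disjoint_left.1 hd h
    simp only [Finset.mem_sdiff, Finset.mem_union]
    tauto
  rw [excess, h1, Finset.card_union_of_disjoint (hd.mono_right hT), excess]
  push_cast
  ring

lemma numComponents_sdiff_eq_one {X Y T : Finset V} (hadj : ∀ x ∈ X, ∀ y ∈ Y, G.Adj x y)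
    (hX : ¬ X ⊆ T) (hY : ¬ Y ⊆ T) : numComponents G ((X ∪ Y) \ T) = 1 := by
  rw [Finset.union_sdiff_distrib]
  exact numComponents_eq_one_of_adj (Finset.sdiff_nonempty.2 hX) (Finset.sdiff_nonempty.2 hY)
    (fun x hx y hy => hadj x (Finset.sdiff_subset hx) y (Finset.sdiff_subset hy))

lemma toList_union_perm {X Y : Finset V} (hd : Disjoint X Y) :
    (X ∪ Y).toList.Perm (X.toList ++ Y.toList) := by
  rw [List.perm_ext_iff_of_nodup (Finset.nodup_toList _)]
  · simp
  · exact List.Nodup.append (Finset.nodup_toList _) (Finset.nodup_toList _)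
      (fun a ha hb => Finset.disjoint_left.1 hd (by simpa using ha) (by simpa using hb))

lemma toList_erase_perm {X : Finset V} {x : V} (hx : x ∈ X) :
    X.toList.Perm (x :: (X.erase x).toList) := by
  rw [List.perm_ext_iff_of_nodup (Finset.nodup_toList _)]
  · intro a
    by_cases h : a = x <;> simp [h, hx]
  · simp [Finset.nodup_toList]

lemma IsMaxExcess.inter_left {X Y T : Finset V} (h : IsMaxExcess G (X ∪ Y) T) (hd : Disjoint X Y)
    (hadj : ∀ x ∈ X, ∀ y ∈ Y, ¬ G.Adj x y) : IsMaxExcess G X (T ∩ X) := by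
  refine ⟨Finset.inter_subset_right, fun T' hT' => ?_⟩
  have hT : T = T ∩ X ∪ T ∩ Y := by
    rw [← Finset.inter_union_distrib_left, Finset.inter_eq_left.2 h.1]
  have h1 := excess_union hd hadj (S := T ∩ X) (T := T ∩ Y) Finset.inter_subset_right
    Finset.inter_subset_right
  have h2 := excess_union hd hadj hT' (T := T ∩ Y) Finset.inter_subset_right
  rw [← hT] at h1
  obtain ⟨h3, h4⟩ := h.2 (T' ∪ T ∩ Y) (Finset.union_subset_union hT' Finset.inter_subset_right)
  refine ⟨by omega, fun hlt => ?_⟩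
  have : T ⊂ T' ∪ T ∩ Y := by
    obtain ⟨z, hz, hzT⟩ := Finset.exists_of_ssubset hlt
    refine Finset.ssubset_iff_subset_ne.2 ⟨?_, ?_⟩
    · nth_rewrite 1 [hT]
      exact Finset.union_subset_union hlt.1 subset_rfl
    · intro he
      refine hzT (Finset.mem_inter.2 ⟨?_, hT' hz⟩)
      rw [he]
      exact Finset.mem_union_left _ hz
  have := h4 this
  omega

lemma HasCover.union {X Y : Finset V} (hX : HasCover G X) (hY : HasCover G Y) (hXn : X.Nonempty)
    (hYn : Y.Nonempty) (hd : Disjoint X Y) (hadj : ∀ x ∈ X, ∀ y ∈ Y, ¬ G.Adj x y) :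
    HasCover G (X ∪ Y) := by
  intro T hT v hv hvT
  wlog hvX : v ∈ X generalizing X Y
  · rw [Finset.union_comm] at hT hv ⊢
    exact this hY hX hYn hXn hd.symm (fun a ha b hb h => hadj b hb a ha h.symm) hT hv
      ((Finset.mem_union.1 hv).resolve_right hvX)
  obtain ⟨m, hm, hmb⟩ := hX _ (hT.inter_left hd hadj) v hvX (by simp [hvT])
  have hTY : IsMaxExcess G Y (T ∩ Y) := by
    rw [Finset.union_comm] at hT
    exact hT.inter_left hd.symm (fun a ha b hb h => hadj b hb a ha h.symm)
  obtain ⟨l, hl, hlb⟩ := hY.exists_list hTY hYn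
  refine ⟨m ++ l, (hm.append hl).trans (toList_union_perm hd).symm, ?_⟩
  have hTe : T = T ∩ X ∪ T ∩ Y := by
    rw [← Finset.inter_union_distrib_left, Finset.inter_eq_left.2 hT.1]
  rw [hTe, excess_union hd hadj Finset.inter_subset_right Finset.inter_subset_right]
  have := breaks_append_le (G := G) (v :: m) l
  rw [List.cons_append] at this
  omega

lemma HasCover.join_of_subset {X Y T : Finset V} (hY : HasCover G Y) (hd : Disjoint X Y)
    (hadj : ∀ x ∈ X, ∀ y ∈ Y, G.Adj x y) (hT : IsMaxExcess G (X ∪ Y) T) (hXT : X ⊆ T) {v : V}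
    (hv : v ∈ X ∪ Y) (hvT : v ∉ T) :
    ∃ m, (v :: m).Perm (X ∪ Y).toList ∧ (breaks G (v :: m) : ℤ) + 1 ≤ excess G (X ∪ Y) T := by
  have hpos := hT.one_le ⟨v, hv⟩
  obtain ⟨S, hS, rfl⟩ : ∃ S ⊆ Y, T = X ∪ S :=
    ⟨T \ X, sdiff_le_iff.2 hT.1, (Finset.union_sdiff_of_subset hXT).symm⟩
  have hSY : IsMaxExcess G Y S := by
    refine ⟨hS, fun S' hS' => ?_⟩
    obtain ⟨h1, h2⟩ := hT.2 (X ∪ S') (Finset.union_subset_union subset_rfl hS')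
    rw [excess_union_left hd hS, excess_union_left hd hS'] at h1 h2
    refine ⟨by omega, fun hlt => ?_⟩
    have : X ∪ S ⊂ X ∪ S' := by
      obtain ⟨z, hz, hzS⟩ := Finset.exists_of_ssubset hlt
      refine ⟨Finset.union_subset_union subset_rfl hlt.1, fun hle => ?_⟩
      rcases Finset.mem_union.1 (hle (Finset.mem_union_right _ hz)) with h | h
      · exact Finset.disjoint_left.1 hd h (hS' hz)
      · exact hzS h
    have := h2 this
    omega
  simp only [Finset.mem_union, not_or] at hv hvT
  obtain ⟨m, hm, hmb⟩ := hY S hSY v (hv.resolve_left hvT.1) hvT.2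
  rw [excess_union_left hd hS] at hpos ⊢
  have hcard := excess_le_card (G := G) Y S
  have hlen := hm.length_eq
  simp only [List.length_cons, Finset.length_toList] at hlen
  obtain ⟨m', hm', hb⟩ := exists_insert_breaks_of_length_le (G := G) m v X.toList
    (fun x hx y hy => hadj x (by simpa using hx) y (by simpa using hm.mem_iff.1 hy))
    (by rw [Finset.length_toList]; omega)
  refine ⟨m', ?_, ?_⟩
  · refine ((hm'.cons v).trans ?_).trans (toList_union_perm hd).symm
    exact (hm.append_right X.toList).trans List.perm_append_comm
  · rw [Finset.length_toList] at hb
    omega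

lemma exists_list_of_card_le {X Y : Finset V} (hd : Disjoint X Y)
    (hadj : ∀ x ∈ X, ∀ y ∈ Y, G.Adj x y) (hle : X.card ≤ Y.card) {l : List V}
    (hl : l.Perm Y.toList) (hb : breaks G l + 1 ≤ X.card) {v : V} (hv : v ∈ X ∪ Y) :
    ∃ m, (v :: m).Perm (X ∪ Y).toList ∧ breaks G (v :: m) = 0 := by
  have hU := toList_union_perm hd
  have hlY : ∀ y ∈ l, y ∈ Y := fun y hy => by simpa using hl.mem_iff.1 hy
  have hlen := hl.length_eq
  rw [Finset.length_toList] at hlen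
  rcases Finset.mem_union.1 hv with hv | hv
  · obtain ⟨a, l, rfl⟩ := List.exists_cons_of_ne_nil (l := l) (by rintro rfl; simp at hlen; omega)
    have hcard := Finset.card_erase_of_mem hv
    simp only [List.length_cons] at hlen
    obtain ⟨m, hm, -, hmb⟩ := exists_insert_breaks (G := G) l a (X.erase v).toList
      (fun x hx y hy => hadj x (Finset.mem_of_mem_erase (by simpa using hx)) y (hlY y hy))
      (by rw [Finset.length_toList]; omega)
    have hmY : ∀ y ∈ l, y ∈ Y := fun y hy => hlY y (by simp [hy])
    refine ⟨a :: m, ?_, ?_⟩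
    · rw [List.perm_iff_count] at *
      intro z
      have h1 := hm z
      have h2 := hl z
      have h3 := hU z
      have h4 := (toList_erase_perm hv).count_eq z
      simp only [List.count_cons, List.count_append] at *
      omega
    · rw [breaks_cons_cons_of_adj (hadj v hv a (hlY a (by simp)))]
      rw [Finset.length_toList] at hmb
      omega
  · obtain ⟨p, q, rfl⟩ := List.append_of_mem (hl.mem_iff.2 (Finset.mem_toList.2 hv))
    have h1 := breaks_append_le (G := G) (v :: q) p
    have h2 := le_breaks_append (G := G) p (v :: q)
    simp only [List.length_append, List.length_cons] at hlen
    obtain ⟨m, hm, hmb⟩ := exists_insert_breaks_of_length_le (G := G) (q ++ p) v X.toList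
      (fun x hx y hy => hadj x (by simpa using hx) y (hlY y (by simp at hy ⊢; tauto)))
      (by rw [Finset.length_toList, List.length_append]; omega)
    refine ⟨m, ?_, ?_⟩
    · rw [List.perm_iff_count] at *
      intro z
      have h1 := hm z
      have h2 := hl z
      have h3 := hU z
      simp only [List.count_cons, List.count_append] at *
      omega
    · rw [Finset.length_toList] at hmb
      rw [List.cons_append] at h1
      omega

lemma HasCover.join {X Y : Finset V} (hX : HasCover G X) (hY : HasCover G Y) (hXn : X.Nonempty)
    (hYn : Y.Nonempty) (hd : Disjoint X Y) (hadj : ∀ x ∈ X, ∀ y ∈ Y, G.Adj x y) :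
    HasCover G (X ∪ Y) := by
  intro T hT v hv hvT
  have hpos := hT.one_le ⟨v, hv⟩
  by_cases hT0 : T = ∅
  · subst hT0
    suffices ∃ m, (v :: m).Perm (X ∪ Y).toList ∧ breaks G (v :: m) = 0 by
      obtain ⟨m, hm, hmb⟩ := this
      exact ⟨m, hm, by rw [hmb]; exact hpos⟩
    wlog hle : X.card ≤ Y.card generalizing X Y
    · rw [Finset.union_comm] at hT hpos hv ⊢
      exact this hY hX hYn hXn hd.symm (fun a ha b hb => (hadj b hb a ha).symm) hv hT hpos
        (by omega)
    obtain ⟨S, hS⟩ := exists_isMaxExcess (G := G) Y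
    obtain ⟨l, hl, hlb⟩ := hY.exists_list hS hYn
    refine exists_list_of_card_le hd hadj hle hl ?_ hv
    have h1 := (hT.2 (X ∪ S) (Finset.union_subset_union subset_rfl hS.1)).2
      (Finset.empty_ssubset.2 (hXn.mono Finset.subset_union_left))
    have h0 : excess G (X ∪ Y) ∅ = 1 := by
      simp [excess, numComponents_eq_one_of_adj hXn hYn hadj]
    rw [excess_union_left hd hS.1, h0] at h1
    omega
  · by_cases hXT : X ⊆ T
    · exact hY.join_of_subset hd hadj hT hXT hv hvT
    by_cases hYT : Y ⊆ T
    · rw [Finset.union_comm] at hT hv ⊢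
      exact hX.join_of_subset hd.symm (fun a ha b hb => (hadj b hb a ha).symm) hT hYT hv hvT
    · have h0 := Finset.card_pos.2 (Finset.nonempty_iff_ne_empty.2 hT0)
      rw [excess, numComponents_sdiff_eq_one hadj hXT hYT] at hpos
      omega

/-- The path cover number of a `P₄`-free graph is determined by its scattering number. -/
lemma NoInducedP4.hasCover (h : NoInducedP4 G.Adj) (W : Finset V) : HasCover G W := by
  induction W using Finset.strongInduction with
  | H W ih =>
    by_cases hW : W.Nontrivial
    · have hlt {X Y : Finset V} (hYn : Y.Nonempty) (hd : Disjoint X Y) : X ⊂ X ∪ Y := by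
        obtain ⟨y, hy⟩ := hYn
        exact ⟨Finset.subset_union_left, fun hle =>
          Finset.disjoint_left.1 hd (hle (Finset.mem_union_right _ hy)) hy⟩
      rcases h.hasSplit hW with ⟨X, Y, hX, hY, hd, rfl, hadj⟩ | ⟨X, Y, hX, hY, hd, rfl, hadj⟩
      · exact (ih X (hlt hY hd)).join
          (ih Y (by rw [Finset.union_comm]; exact hlt hX hd.symm)) hX hY hd hadj
      · exact (ih X (hlt hY hd)).union
          (ih Y (by rw [Finset.union_comm]; exact hlt hX hd.symm)) hX hY hd
          (fun x hx y hy => (hadj x hx y hy).2)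
    · intro T hT v hv hvT
      obtain ⟨w, rfl⟩ : ∃ w, W = {w} :=
        (Finset.Nonempty.exists_eq_singleton_or_nontrivial ⟨v, hv⟩).resolve_right hW
      obtain rfl : v = w := by simpa using hv
      have := hT.one_le ⟨v, hv⟩
      exact ⟨[], by simp, by simpa [breaks] using this⟩

end Cover

section Hamiltonian

variable {V : Type*} [DecidableEq V] {G : SimpleGraph V}

lemma not_adj_of_excess_eq_card {A T : Finset V} (h : excess G A T = A.card) {x y : V}
    (hx : x ∈ A) (hy : y ∈ A) : ¬ G.Adj x y := by
  have h1 := numComponents_le_card (G := G) (A \ T)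
  have h2 := Finset.card_le_card (Finset.sdiff_subset (s := A) (t := T))
  rw [excess] at h
  obtain rfl : T = ∅ := by rw [← Finset.card_eq_zero]; omega
  rw [Finset.sdiff_empty, Finset.card_empty] at h
  exact not_adj_of_numComponents_eq_card (by omega) hx hy

/-- In the join of `A` and `B`, where `A` can be covered by `|B|` paths one of which starts at `v`,
there is a Hamiltonian path from `v` to any vertex of `B`. -/
lemma exists_list_getLast_of_mem_right {A B : Finset V} (hd : Disjoint A B)
    (hadj : ∀ a ∈ A, ∀ b ∈ B, G.Adj a b) (hle : B.card ≤ A.card) {v u : V} {m : List V}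
    (hm : (v :: m).Perm A.toList) (hmb : breaks G (v :: m) + 1 ≤ B.card) (hu : u ∈ B) :
    ∃ m, (v :: m).Perm (A ∪ B).toList ∧ breaks G (v :: m) = 0 ∧ (v :: m).getLast? = some u := by
  have hlen := hm.length_eq
  have hmA : ∀ y ∈ v :: m, y ∈ A := fun y hy => by simpa using hm.mem_iff.1 hy
  have hcard := Finset.card_erase_of_mem hu
  simp only [List.length_cons, Finset.length_toList] at hlen
  obtain ⟨l, hl, hlast, hlb⟩ := exists_insert_breaks (G := G) m v (B.erase u).toList
    (fun x hx y hy => (hadj y (hmA y hy) x (Finset.mem_of_mem_erase (by simpa using hx))).symm)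
    (by rw [Finset.length_toList]; omega)
  have hlast' : (v :: m).getLast (by simp) ∈ (v :: l).getLast? := by
    rw [hlast]; exact List.getLast_mem_getLast? _
  have h1 := breaks_concat_of_adj_getLast hlast'
    (hadj _ (hmA _ (List.getLast_mem (by simp))) u hu)
  rw [Finset.length_toList] at hlb
  refine ⟨l ++ [u], ?_, ?_, ?_⟩
  · have hU := toList_union_perm hd
    have hE := toList_erase_perm hu
    rw [List.perm_iff_count] at *
    intro z
    have h1 := hm z
    have h2 := hl z
    have h3 := hU z
    have h4 := hE z
    simp only [List.count_cons, List.count_append, List.count_nil] at *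
    omega
  · rw [List.cons_append] at h1
    omega
  · rw [← List.cons_append, List.getLast?_concat]

/-- In the join of `A` and `B`, where `A` can be covered by `|B|` paths one of which starts at `v`,
there is a Hamiltonian path from `v` to any other vertex of `A`, unless the join is a balanced
complete bipartite graph. -/
lemma exists_list_getLast_of_mem_left {A B : Finset V} (hd : Disjoint A B)
    (hadj : ∀ a ∈ A, ∀ b ∈ B, G.Adj a b) (hle : B.card ≤ A.card)
    (hedge : B.card = A.card → ∃ x ∈ B, ∃ y ∈ B, G.Adj x y) {v u : V} {m : List V}
    (hm : (v :: m).Perm A.toList) (hmb : breaks G (v :: m) + 1 ≤ B.card) (hu : u ∈ m) :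
    ∃ m, (v :: m).Perm (A ∪ B).toList ∧ breaks G (v :: m) = 0 ∧ (v :: m).getLast? = some u := by
  have hU := toList_union_perm hd
  have hlen := hm.length_eq
  simp only [List.length_cons, Finset.length_toList] at hlen
  obtain ⟨l, hl, hlast, hlb⟩ : ∃ l, l.Perm m ∧ l.getLast? = some u ∧
      breaks G (v :: l) ≤ B.card := by
    obtain ⟨p, q, rfl⟩ := List.append_of_mem hu
    refine ⟨p ++ (u :: q).reverse, (List.reverse_perm _).append_left p, by simp, ?_⟩
    have h1 := breaks_append_le (G := G) (v :: p) (u :: q).reverse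
    have h2 := le_breaks_append (G := G) (v :: p) (u :: q)
    have h3 := breaks_reverse_le (G := G) (u :: q)
    rw [List.cons_append] at h1 h2
    omega
  have hlA : ∀ y ∈ v :: l, y ∈ A := fun y hy => by simpa using ((hl.cons v).trans hm).mem_iff.1 hy
  have hlm := hl.length_eq
  have hlastv (a : V) : (a :: l).getLast? = some u := by
    rw [List.getLast?_cons, hlast]; rfl
  by_cases hcard : B.card = A.card
  · obtain ⟨x, hx, y, hy, hxy⟩ := hedge hcard
    obtain ⟨c, l, rfl⟩ := List.exists_cons_of_ne_nil (l := l) (by rintro rfl; simp at hlast)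
    have hyx : y ∈ B.erase x := Finset.mem_erase.2 ⟨hxy.ne', hy⟩
    have hc1 := Finset.card_erase_of_mem hx
    have hc2 := Finset.card_erase_of_mem hyx
    simp only [List.length_cons] at hlm
    obtain ⟨k, hk, hklast, hkb⟩ := exists_insert_breaks (G := G) l c ((B.erase x).erase y).toList
      (fun z hz w hw => (hadj w (hlA w (List.mem_cons_of_mem _ hw)) z
        (Finset.mem_of_mem_erase (Finset.mem_of_mem_erase (by simpa using hz)))).symm)
      (by rw [Finset.length_toList]; omega)
    refine ⟨x :: y :: c :: k, ?_, ?_, ?_⟩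
    · have hE := toList_erase_perm hx
      have hE' := toList_erase_perm hyx
      rw [List.perm_iff_count] at *
      intro z
      have h1 := hm z
      have h2 := hl z
      have h3 := hU z
      have h4 := hE z
      have h5 := hE' z
      have h6 := hk z
      simp only [List.count_cons, List.count_append] at *
      omega
    · rw [breaks_cons_cons_of_adj (hadj v (hlA v (by simp)) x hx), breaks_cons_cons_of_adj hxy,
        breaks_cons_cons_of_adj (hadj c (hlA c (by simp)) y hy).symm]
      have := breaks_le_length (G := G) c l
      rw [Finset.length_toList] at hkb
      omega
    · rw [hlast] at hklast
      simpa using hklast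
  · obtain ⟨k, hk, hklast, hkb⟩ := exists_insert_breaks (G := G) l v B.toList
      (fun z hz w hw => (hadj w (hlA w hw) z (by simpa using hz)).symm)
      (by rw [Finset.length_toList]; omega)
    refine ⟨k, ?_, ?_, hklast.trans (hlastv v)⟩
    · exact ((hk.cons v).trans (((hl.cons v).trans hm).append_right B.toList)).trans hU.symm
    · rw [Finset.length_toList] at hkb
      omega

lemma exists_isHamiltonian_of_perm [Fintype V] {u v : V} {m : List V}
    (hm : (v :: m).Perm Finset.univ.toList) (hb : breaks G (v :: m) = 0)
    (hlast : (v :: m).getLast? = some u) : ∃ p : G.Walk v u, p.IsHamiltonian := by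
  have hu : (v :: m).getLast (by simp) = u := by
    rw [List.getLast?_eq_some_getLast (by simp)] at hlast
    simpa using hlast
  subst hu
  have hchain := isChain_of_breaks_eq_zero hb
  refine ⟨Walk.ofSupport (v :: m) (List.cons_ne_nil v m) hchain, fun a => ?_⟩
  refine (congrArg (List.count a) (Walk.support_ofSupport (List.cons_ne_nil v m) hchain)).trans ?_
  rw [hm.count_eq, List.count_eq_one_of_mem (Finset.nodup_toList _) (by simp)]

lemma SimpleGraph.Walk.IsHamiltonian.reverse {u v : V} {p : G.Walk u v} (hp : p.IsHamiltonian) :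
    p.reverse.IsHamiltonian := fun a => by
  rw [Walk.support_reverse, List.count_reverse, hp a]

lemma ncomps_coe [Fintype V] (T : Finset V) :
    ncomps G (T : Set V) = numComponents G (Finset.univ \ T) := by
  have : (T : Set V)ᶜ = ((Finset.univ \ T : Finset V) : Set V) := by ext; simp
  rw [ncomps, this, numComponents]

/-- If `G` is a join of `A` and `B` with `B` contained in a maximal scattering set `S`, then there
are Hamiltonian paths from each vertex outside `S` to every other vertex. -/
lemma exists_isHamiltonian_of_join [Fintype V] (hfree : P4Free G) {S : Finset V}
    (hS : IsMaxScatSet G (S : Set V)) (h0 : ncomps G (S : Set V) = S.card)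
    (hnotbal : ¬ ∃ A : Set V, A.ncard = Aᶜ.ncard ∧
      ∀ u v : V, G.Adj u v ↔ ((u ∈ A ∧ v ∈ Aᶜ) ∨ (u ∈ Aᶜ ∧ v ∈ A)))
    {A B : Finset V} (hB : B.Nonempty) (hd : Disjoint A B)
    (hAB : A ∪ B = Finset.univ) (hadj : ∀ a ∈ A, ∀ b ∈ B, G.Adj a b) (hBS : B ⊆ S)
    {u v : V} (huv : u ≠ v) (hv : v ∉ S) : ∃ p : G.Walk v u, p.IsHamiltonian := by
  have hBA : B ∪ A = Finset.univ := by rw [Finset.union_comm, hAB]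
  have hmem (z : V) : z ∈ A ∨ z ∈ B := Finset.mem_union.1 (hAB ▸ Finset.mem_univ z)
  obtain ⟨T, hT, rfl⟩ : ∃ T ⊆ A, S = B ∪ T :=
    ⟨S \ B, sdiff_le_iff.2 (by rw [Finset.sup_eq_union, hBA]; exact Finset.subset_univ S),
      (Finset.union_sdiff_of_subset hBS).symm⟩
  have hv' : v ∉ B ∧ v ∉ T := by simpa using hv
  have hvA := (hmem v).resolve_right hv'.1
  have hexc {T' : Finset V} (hT' : T' ⊆ A) :
      (ncomps G ((B ∪ T' : Finset V) : Set V) : ℤ) - (B ∪ T').card =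
        excess G A T' - B.card := by
    rw [← excess_union_left hd.symm hT', excess, hBA, ncomps_coe]
  have hT0 := hexc hT
  rw [h0] at hT0
  have hBpos := hB.card_pos
  have h2 := hS.1.1
  have hmax : IsMaxExcess G A T := by
    refine ⟨hT, fun T' hT' => ?_⟩
    have h1 := hexc hT'
    by_cases hc : 2 ≤ ncomps G ((B ∪ T' : Finset V) : Set V)
    · have hle := hS.1.2 _ hc
      simp only [Set.ncard_coe_finset] at hle
      refine ⟨by omega, fun hlt => lt_of_le_of_ne (by omega) fun heq => ?_⟩
      have hsub : B ∪ T ⊆ B ∪ T' := Finset.union_subset_union subset_rfl hlt.1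
      have heq' := hS.2 ((B ∪ T' : Finset V) : Set V) ⟨hc, fun W hW => by
        have := hS.1.2 W hW
        simp only [Set.ncard_coe_finset] at this ⊢
        omega⟩ (by exact_mod_cast hsub)
      have heq'' : B ∪ T = B ∪ T' := by exact_mod_cast heq'
      obtain ⟨z, hz, hzT⟩ := Finset.exists_of_ssubset hlt
      have hz' : z ∈ B ∪ T := heq'' ▸ Finset.mem_union_right _ hz
      rcases Finset.mem_union.1 hz' with h | h
      · exact Finset.disjoint_left.1 hd (hT' hz) h
      · exact hzT h
    · have h3 := Finset.card_union_of_disjoint (hd.symm.mono_right hT')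
      refine ⟨by omega, fun hlt => ?_⟩
      have h4 := Finset.card_lt_card hlt
      omega
  obtain ⟨m, hm, hmb⟩ := hfree.noInducedP4.hasCover A T hmax v hvA hv'.2
  have hle := excess_le_card (G := G) A T
  have key : ∃ m, (v :: m).Perm (A ∪ B).toList ∧ breaks G (v :: m) = 0 ∧
      (v :: m).getLast? = some u := by
    rcases hmem u with hu | hu
    · refine exists_list_getLast_of_mem_left hd hadj (by omega) (fun hcard => ?_) hm (by omega) ?_
      · by_contra! hno
        refine hnotbal ⟨A, ?_, fun x y => ?_⟩
        · have hc : (A : Set V)ᶜ = B := by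
            ext z
            have h1 : z ∈ A → z ∉ B := fun h => Finset.disjoint_left.1 hd h
            have h2 := hmem z
            simp only [Set.mem_compl_iff, Finset.mem_coe]
            tauto
          rw [hc, Set.ncard_coe_finset, Set.ncard_coe_finset, hcard]
        · have hA := not_adj_of_excess_eq_card (G := G) (A := A) (T := T) (by omega) (x := x) (y := y)
          simp only [Set.mem_compl_iff, Finset.mem_coe]
          have h1 := hmem x
          have h2 := hmem y
          have h3 := hadj x
          have h4 : x ∈ B → y ∈ A → G.Adj x y := fun hx hy => (hadj y hy x hx).symm
          have h5 := hno x
          have h6 : x ∈ A → x ∉ B := fun h => Finset.disjoint_left.1 hd h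
          have h7 : y ∈ A → y ∉ B := fun h => Finset.disjoint_left.1 hd h
          grind
      · have : u ∈ v :: m := hm.mem_iff.2 (Finset.mem_toList.2 hu)
        exact (List.mem_cons.1 this).resolve_left huv
    · exact exists_list_getLast_of_mem_right hd hadj (by omega) hm (by omega) hu
  obtain ⟨m, hm, hb, hlast⟩ := key
  rw [hAB] at hm
  exact exists_isHamiltonian_of_perm hm hb hlast

lemma exists_isHamiltonian_of_notMem [Fintype V] (hfree : P4Free G) {S : Finset V}
    (hS : IsMaxScatSet G (S : Set V)) (h0 : ncomps G (S : Set V) = S.card)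
    (hnotbal : ¬ ∃ A : Set V, A.ncard = Aᶜ.ncard ∧
      ∀ u v : V, G.Adj u v ↔ ((u ∈ A ∧ v ∈ Aᶜ) ∨ (u ∈ Aᶜ ∧ v ∈ A)))
    {u v : V} (huv : u ≠ v) (hv : v ∉ S) : ∃ p : G.Walk v u, p.IsHamiltonian := by
  have hnt : (Finset.univ : Finset V).Nontrivial := ⟨u, by simp, v, by simp, huv⟩
  rcases hfree.noInducedP4.hasSplit hnt with ⟨X, Y, hX, hY, hd, hXY, hadj⟩ |
    ⟨X, Y, hX, hY, hd, hXY, hadj⟩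
  · by_cases hXS : X ⊆ S
    · exact exists_isHamiltonian_of_join hfree hS h0 hnotbal hX hd.symm
        (by rw [Finset.union_comm, hXY]) (fun a ha b hb => (hadj b hb a ha).symm) hXS huv hv
    by_cases hYS : Y ⊆ S
    · exact exists_isHamiltonian_of_join hfree hS h0 hnotbal hY hd hXY hadj hYS huv hv
    · have h1 := hS.1.1
      rw [ncomps_coe, ← hXY, numComponents_sdiff_eq_one hadj hXS hYS] at h1
      omega
  · have h1 : ncomps G ((∅ : Finset V) : Set V) = numComponents G X + numComponents G Y := by
      rw [ncomps_coe, Finset.sdiff_empty, ← hXY,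
        numComponents_union hd (fun x hx y hy => (hadj x hx y hy).2)]
    have h2 := numComponents_pos (G := G) hX
    have h3 := numComponents_pos (G := G) hY
    have h4 := hS.1.2 ((∅ : Finset V) : Set V) (by omega)
    simp only [Set.ncard_coe_finset, Finset.card_empty] at h4
    omega

end Hamiltonian

theorem stmt8 {V : Type*} [Fintype V] [DecidableEq V] (G : SimpleGraph V) (hfree : P4Free G)
    (S : Set V) (hS : IsMaxScatSet G S) (h0 : ncomps G S = S.ncard)
    (hnotbal : ¬ ∃ A : Set V, A.ncard = Aᶜ.ncard ∧
      ∀ u v : V, G.Adj u v ↔ ((u ∈ A ∧ v ∈ Aᶜ) ∨ (u ∈ Aᶜ ∧ v ∈ A)))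
    (u v : V) (huv : u ≠ v) (hS1 : u ∉ S ∨ v ∉ S) :
    ∃ p : G.Walk u v, p.IsHamiltonian := by
  lift S to Finset V using S.toFinite
  rw [Set.ncard_coe_finset] at h0
  rcases hS1 with h | h
  · exact exists_isHamiltonian_of_notMem hfree hS h0 hnotbal huv.symm h
  · obtain ⟨p, hp⟩ := exists_isHamiltonian_of_notMem hfree hS h0 hnotbal huv h
    exact ⟨p.reverse, hp.reverse⟩
end
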